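/- A 3-connected constraint graph (G,X) is constraint connected if and only if it has no constraint minor isomorphic to one of the six obstructions: the constraint K4, the constraint wheel, or one of the four constraint prisms. -/

import Mathlib

open SimpleGraph

/-- An edge set `X` is connected: any two vertices covered by `X` are joined by a path
consisting of edges of `X`.  (The empty edge set counts as connected.) -/
def EdgeSetConnected {V : Type*} (X : Set (Sym2 V)) : Prop :=
  ∀ u ∈ (fromEdgeSet X).support, ∀ v ∈ (fromEdgeSet X).support, (fromEdgeSet X).Reachable u v

/-- The subgraph `G[X]` spanned by an edge set `X`, as a graph on the covered vertices. -/
def edgeSubgraph {V : Type*} (X : Set (Sym2 V)) :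
    SimpleGraph ((fromEdgeSet X).support) :=
  (fromEdgeSet X).induce (fromEdgeSet X).support

/-- The number of connected components of `G[X]`. -/
noncomputable def edgeComponents {V : Type*} (X : Set (Sym2 V)) : ℕ :=
  Nat.card (edgeSubgraph X).ConnectedComponent

/-- A graph is `k`-connected if it has more than `k` vertices and deleting fewer than `k`
vertices always leaves a connected graph. -/
def KConnected {V : Type*} (k : ℕ) (G : SimpleGraph V) : Prop :=
  k < Nat.card V ∧ ∀ S : Set V, S.ncard < k → (G.induce Sᶜ).Connected

/-- A constraint graph: a finite simple graph `G` together with a set `X` of edges. -/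
structure CGraph : Type 1 where
  V : Type
  G : SimpleGraph V
  X : Set (Sym2 V)
  fin : Finite V := by infer_instance

attribute [instance] CGraph.fin

/-- `X` really is a set of edges of `G`. -/
def CGraph.WF (C : CGraph) : Prop := C.X ⊆ C.G.edgeSet

/-- The vertex map contracting `v` onto `u`. -/
noncomputable def contractFun {V : Type*} {u v : V} (huv : u ≠ v) (x : V) : {w : V // w ≠ v} :=
  letI := Classical.decEq V
  if h : x = v then ⟨u, huv⟩ else ⟨x, h⟩

/-- Contraction of a simple graph, identifying `v` with `u` (loops are discarded, parallel
edges are merged, so the result is simple). -/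
noncomputable def contractGraph {V : Type*} (G : SimpleGraph V) {u v : V} (huv : u ≠ v) :
    SimpleGraph {w : V // w ≠ v} :=
  fromEdgeSet (Sym2.map (contractFun huv) '' G.edgeSet)

/-- Contraction of a constraint graph: identify `v` with `u`; the new constraint consists of all
non-loop images of constraint edges; thus in each parallel class edges of `X` are preferred. -/
noncomputable def CGraph.contract (C : CGraph) (u v : C.V) (huv : u ≠ v) : CGraph where
  V := {w : C.V // w ≠ v}
  G := contractGraph C.G huv
  X := {e | e ∈ Sym2.map (contractFun huv) '' C.X ∧ ¬ e.IsDiag}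

/-- Deletion of an edge from a constraint graph. -/
def CGraph.deleteEdge (C : CGraph) (e : Sym2 C.V) : CGraph where
  V := C.V
  G := C.G.deleteEdges {e}
  X := C.X

/-- One step in forming a constraint minor: delete an edge not in `X`, or contract an edge. -/
inductive CMinorStep : CGraph → CGraph → Prop
  | del (C : CGraph) (e : Sym2 C.V) (he : e ∈ C.G.edgeSet) (hx : e ∉ C.X) :
      CMinorStep C (C.deleteEdge e)
  | contr (C : CGraph) (u v : C.V) (h : C.G.Adj u v) :
      CMinorStep C (C.contract u v h.ne)

/-- The constraint-minor relation. -/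
def IsCMinor : CGraph → CGraph → Prop := Relation.ReflTransGen CMinorStep

/-- Isomorphism of constraint graphs. -/
def CGIso (C D : CGraph) : Prop :=
  ∃ φ : C.G ≃g D.G, Sym2.map (⇑φ) '' C.X = D.X

/-- The constraint `K₄`. -/
def constraintK4 : CGraph where
  V := Fin 4
  G := ⊤
  X := {s(0, 1), s(2, 3)}

def wheelGraph : SimpleGraph (Fin 5) :=
  fromEdgeSet {s(0, 1), s(1, 2), s(2, 3), s(3, 0), s(0, 4), s(1, 4), s(2, 4), s(3, 4)}

/-- The constraint wheel. -/
def constraintWheel : CGraph where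
  V := Fin 5
  G := wheelGraph
  X := {s(0, 1), s(2, 3)}

/-- The prism `K₃ □ K₂`, with triangles `{0,1,2}` and `{3,4,5}`. -/
def prismGraph : SimpleGraph (Fin 6) :=
  fromEdgeSet {s(0, 1), s(1, 2), s(0, 2), s(3, 4), s(4, 5), s(3, 5), s(0, 3), s(1, 4), s(2, 5)}

def topEdges : Set (Sym2 (Fin 6)) := {s(0, 1), s(1, 2), s(0, 2)}
def botEdges : Set (Sym2 (Fin 6)) := {s(3, 4), s(4, 5), s(3, 5)}

/-- Constraint sets of the four constraint prisms: contained in the two triangles and meeting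
every vertex, inducing a spanning connected subgraph of each triangle. -/
def PrismConstraintSet (X : Set (Sym2 (Fin 6))) : Prop :=
  X ⊆ topEdges ∪ botEdges ∧
  EdgeSetConnected (X ∩ topEdges) ∧ (fromEdgeSet (X ∩ topEdges)).support = {0, 1, 2} ∧
  EdgeSetConnected (X ∩ botEdges) ∧ (fromEdgeSet (X ∩ botEdges)).support = {3, 4, 5}

/-- `C` is one of the four constraint prisms. -/
def IsConstraintPrism (C : CGraph) : Prop :=
  ∃ X, PrismConstraintSet X ∧ CGIso C (CGraph.mk (Fin 6) prismGraph X)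

/-- The six obstructions. -/
def IsObstruction (D : CGraph) : Prop :=
  CGIso D constraintK4 ∨ CGIso D constraintWheel ∨ IsConstraintPrism D

/-- The weird prism. -/
def weirdPrism : CGraph where
  V := Fin 6
  G := prismGraph
  X := {s(0, 3), s(1, 4), s(2, 5)}

/-- The Wagner graph `V₈`. -/
def wagnerGraph : SimpleGraph (Fin 8) :=
  fromEdgeSet {s(0, 1), s(1, 2), s(2, 3), s(3, 4), s(4, 5), s(5, 6), s(6, 7), s(7, 0),
    s(0, 4), s(1, 5), s(2, 6), s(3, 7)}

/-- The constraint Wagner graph: `X` is the complement of the 6-cycle `0-1-5-4-3-7-0`. -/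
def constraintWagner : CGraph where
  V := Fin 8
  G := wagnerGraph
  X := {s(1, 2), s(2, 3), s(5, 6), s(6, 7), s(0, 4), s(2, 6)}

/-- The Wagner prism. -/
def wagnerPrism : CGraph where
  V := Fin 6
  G := prismGraph
  X := {s(0, 3), s(1, 2), s(4, 5)}

/-- `(G, X)` has a 3-connected constraint minor whose constraint is disconnected. -/
def BadMinor (C : CGraph) : Prop :=
  ∃ C', IsCMinor C C' ∧ KConnected 3 C'.G ∧ ¬ EdgeSetConnected C'.X

/-- An edge `e ∉ X` is essential if neither `(G/e, X ∩ E(G/e))` nor `(G∖e, X)` has a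
3-connected constraint minor with disconnected constraint. -/
def Essential (C : CGraph) (e : Sym2 C.V) : Prop :=
  ¬ BadMinor (C.deleteEdge e) ∧
  ∀ u v, ∀ h : C.G.Adj u v, s(u, v) = e → ¬ BadMinor (C.contract u v h.ne)

/-- An edge joining two distinct components of `G[X]`. -/
def JoinsComponents {V : Type*} (X : Set (Sym2 V)) (e : Sym2 V) : Prop :=
  ∃ a b, e = s(a, b) ∧ a ∈ (fromEdgeSet X).support ∧ b ∈ (fromEdgeSet X).support ∧
    ¬ (fromEdgeSet X).Reachable a b

/-- The degree of a vertex. -/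
noncomputable def vdeg {V : Type*} (G : SimpleGraph V) (v : V) : ℕ := (G.neighborSet v).ncard

/-- The component of `G[X]` containing the edge `f` consists of the single edge `f`. -/
def SingleEdgeComponent {V : Type*} (X : Set (Sym2 V)) (f : Sym2 V) : Prop :=
  f ∈ X ∧ ∀ g ∈ X, (∃ a ∈ f, ∃ b ∈ g, (fromEdgeSet X).Reachable a b) → g = f

/-- The edges of `Q` with all endvertices in `S`: the edges of the side `Q[S]`. -/
def sideEdges {V : Type*} (Q : SimpleGraph V) (S : Set V) : Set (Sym2 V) :=
  {e | e ∈ Q.edgeSet ∧ ∀ v ∈ e, v ∈ S}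

/-- The edges of `Q` with one endvertex in `S` and one outside `S`. -/
def crossEdges {V : Type*} (Q : SimpleGraph V) (S : Set V) : Set (Sym2 V) :=
  {e | e ∈ Q.edgeSet ∧ (∃ v ∈ e, v ∈ S) ∧ ∃ v ∈ e, v ∉ S}

/-- `d` is a bond of `Q` with sides induced by `S` and `Sᶜ`. -/
def IsBondWith {V : Type*} (Q : SimpleGraph V) (d : Set (Sym2 V)) (S : Set V) : Prop :=
  S.Nonempty ∧ Sᶜ.Nonempty ∧ (Q.induce S).Connected ∧ (Q.induce Sᶜ).Connected ∧
    d = crossEdges Q S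

/-- `Q` is 3-connected along the bond `d` (with left side `S`): `Q` is 2-connected and no pair
of vertices, one from each side, separates `Q`. -/
def ThreeConnAlong {V : Type*} (Q : SimpleGraph V) (d : Set (Sym2 V)) (S : Set V) : Prop :=
  IsBondWith Q d S ∧ KConnected 2 Q ∧
    ∀ x ∈ S, ∀ y ∈ Sᶜ, (Q.induce ({x, y}ᶜ : Set V)).Preconnected

/-- One step of a special contraction minor: contract an edge not in the bond. -/
inductive SCMStep : CGraph → CGraph → Prop
  | contr (C : CGraph) (u v : C.V) (h : C.G.Adj u v) (hd : s(u, v) ∉ C.X) :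
      SCMStep C (C.contract u v h.ne)

/-- The special-contraction-minor relation. -/
def IsSCMinor : CGraph → CGraph → Prop := Relation.ReflTransGen SCMStep

/-- A proper (non-identical) special contraction minor. -/
def IsProperSCMinor : CGraph → CGraph → Prop := Relation.TransGen SCMStep

/-- The special `K₄`: `K₄` together with a bond of size 4. -/
def specialK4 : CGraph where
  V := Fin 4
  G := ⊤
  X := {s(0, 2), s(0, 3), s(1, 2), s(1, 3)}

/-- The special prism: the prism together with the bond complementing the two triangles. -/
def specialPrism : CGraph where
  V := Fin 6
  G := prismGraph
  X := {s(0, 3), s(1, 4), s(2, 5)}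

/-- `(Q, d)` is 3-connected along `d` and both sides of `d` contain edges. -/
def GoodAlong (C : CGraph) : Prop :=
  ∃ S : Set C.V, ThreeConnAlong C.G C.X S ∧
    (sideEdges C.G S).Nonempty ∧ (sideEdges C.G Sᶜ).Nonempty

/-- `(Q, d)` is irreducible. -/
def BondIrreducible (C : CGraph) : Prop :=
  (∃ S : Set C.V, ThreeConnAlong C.G C.X S) ∧
  ¬ ∃ C', IsProperSCMinor C C' ∧ GoodAlong C'

/-- An edge set forming a triangle. -/
def IsTriangle {V : Type*} (X : Set (Sym2 V)) : Prop :=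
  ∃ a b c : V, a ≠ b ∧ a ≠ c ∧ b ≠ c ∧ X = {s(a, b), s(b, c), s(a, c)}

/-- An edge set consisting of a single edge. -/
def IsSingleEdge {V : Type*} (X : Set (Sym2 V)) : Prop :=
  ∃ a b : V, a ≠ b ∧ X = {s(a, b)}

/-- `M` is (isomorphic to) the cycle matroid of `G`, via the bijection `f` between the ground
set of `M` and the edges of `G`: a set is independent iff its image is a forest. -/
def IsGraphicRep {α : Type} (M : Matroid α) {V : Type} (G : SimpleGraph V)
    (f : α → Sym2 V) : Prop :=
  Set.BijOn f M.E G.edgeSet ∧ ∀ I ⊆ M.E, (M.Indep I ↔ (fromEdgeSet (f '' I)).IsAcyclic)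

/-- The constraint matroid `(M, X)` is realisable. -/
def Realisable {α : Type} (M : Matroid α) (X : Set α) : Prop :=
  ∃ (V : Type) (_ : Finite V) (G : SimpleGraph V) (f : α → Sym2 V),
    IsGraphicRep M G f ∧ EdgeSetConnected (f '' X)

/-- Deletion of a set of elements from a matroid. -/
def Matroid.del {α : Type} (M : Matroid α) (D : Set α) : Matroid α := Matroid.restrict M (M.E \ D)

/-- Contraction of a set of elements of a matroid. -/
def Matroid.con {α : Type} (M : Matroid α) (C : Set α) : Matroid α :=
  Matroid.dual (Matroid.del (Matroid.dual M) C)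

/-- `(N, Y)` is a constraint minor of `(M, X)`: contract an arbitrary set `C` and delete a
set `D` of elements not in `X`. -/
def MatroidCMinor {α : Type} (M : Matroid α) (X : Set α) (N : Matroid α) (Y : Set α) : Prop :=
  ∃ C D : Set α, D ⊆ M.E \ X ∧ N = (M.con C).del D ∧ Y = X \ C

/-- `(N, Y)` is isomorphic, via the cycle matroid, to one of the six obstructions. -/
def MatroidObstruction {α : Type} (N : Matroid α) (Y : Set α) : Prop :=
  (∃ f : α → Sym2 (Fin 4), IsGraphicRep N constraintK4.G f ∧ f '' Y = constraintK4.X) ∨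
  (∃ f : α → Sym2 (Fin 5), IsGraphicRep N constraintWheel.G f ∧ f '' Y = constraintWheel.X) ∨
  (∃ X, PrismConstraintSet X ∧
    ∃ f : α → Sym2 (Fin 6), IsGraphicRep N prismGraph f ∧ f '' Y = X)


section Basics

variable {V : Type*} {G : SimpleGraph V}

/-- `T` is closed under taking `G`-neighbours inside `S`. -/
def Clo (G : SimpleGraph V) (S T : Set V) : Prop := ∀ a ∈ T, ∀ b ∈ S, G.Adj a b → b ∈ T

/-- `S` is a nonempty connected vertex set (cut characterisation). -/
def Cn (G : SimpleGraph V) (S : Set V) : Prop :=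
  S.Nonempty ∧ ∀ T ⊆ S, T.Nonempty → Clo G S T → S ⊆ T

/-- Two vertex sets are joined by an edge. -/
def Tch (G : SimpleGraph V) (S T : Set V) : Prop := ∃ a ∈ S, ∃ b ∈ T, G.Adj a b

theorem Tch.symm {S T : Set V} (h : Tch G S T) : Tch G T S := by
  obtain ⟨a, ha, b, hb, hab⟩ := h
  exact ⟨b, hb, a, ha, hab.symm⟩

theorem Tch.mono {S T S' T' : Set V} (h : Tch G S T) (hS : S ⊆ S') (hT : T ⊆ T') :
    Tch G S' T' := by
  obtain ⟨a, ha, b, hb, hab⟩ := h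
  exact ⟨a, hS ha, b, hT hb, hab⟩

theorem Clo.compl {S T : Set V} (h : Clo G S T) (_ : T ⊆ S) : Clo G S (S \ T) := by
  intro a ha b hb hab
  refine ⟨hb, fun hbT => ha.2 (h b hbT a ha.1 hab.symm)⟩

/-- A connected set meeting a closed set is contained in it. -/
theorem Cn.sub_of_clo {S T W : Set V} (hW : Cn G W) (hWS : W ⊆ S) (hT : Clo G S T)
    {w : V} (hw : w ∈ W) (hwT : w ∈ T) : W ⊆ T := by
  have := hW.2 (T ∩ W) Set.inter_subset_right ⟨w, hwT, hw⟩
    (fun a ha b hb hab => ⟨hT a ha.1 b (hWS hb) hab, hb⟩)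
  exact fun x hx => (this hx).1

theorem cn_of_root {S : Set V} {b : V} (hb : b ∈ S)
    (h : ∀ T ⊆ S, T.Nonempty → Clo G S T → b ∈ T) : Cn G S := by
  refine ⟨⟨b, hb⟩, fun T hT hne hc => ?_⟩
  intro x hx
  by_contra hxT
  exact (h (S \ T) Set.sdiff_subset ⟨x, hx, hxT⟩ (hc.compl hT)).2 (h T hT hne hc)

theorem cn_singleton (b : V) : Cn G {b} := by
  refine cn_of_root (b := b) rfl ?_
  intro T hT hne _
  obtain ⟨x, hx⟩ := hne
  have : x = b := hT hx
  exact this ▸ hx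

theorem Cn.union {S T : Set V} (hS : Cn G S) (hT : Cn G T) (h : Tch G S T) : Cn G (S ∪ T) := by
  obtain ⟨a, ha, b, hb, hab⟩ := h
  refine cn_of_root (b := a) (Or.inl ha) ?_
  intro U hU hne hc
  obtain ⟨x, hx⟩ := hne
  have key : ∀ y ∈ S, y ∈ U → a ∈ U := fun y hy hyU =>
    hS.sub_of_clo Set.subset_union_left hc hy hyU ha
  rcases hU hx with h1 | h1
  · exact key x h1 hx
  · have : b ∈ U := hT.sub_of_clo Set.subset_union_right hc h1 hx hb
    exact hc b this a (Or.inl ha) hab.symm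

/-- The component of `v` in `S`. -/
def cmpo (G : SimpleGraph V) (S : Set V) (v : V) : Set V :=
  {w | ∀ C ⊆ S, v ∈ C → Clo G S C → w ∈ C}

theorem mem_cmpo {S : Set V} {v : V} : v ∈ cmpo G S v := fun _ _ h _ => h

theorem cmpo_sub {S : Set V} {v : V} (hv : v ∈ S) : cmpo G S v ⊆ S :=
  fun _ hw => hw S subset_rfl hv (fun _ _ _ hb _ => hb)

theorem cmpo_clo {S : Set V} {v : V} : Clo G S (cmpo G S v) :=
  fun a ha b hb hab C hC hvC hcl => hcl a (ha C hC hvC hcl) b hb hab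

theorem cmpo_cn {S : Set V} {v : V} (hv : v ∈ S) : Cn G (cmpo G S v) := by
  refine cn_of_root (b := v) mem_cmpo ?_
  intro T hT hne hc
  by_contra hvT
  obtain ⟨x, hx⟩ := hne
  have := hT hx (S \ T) Set.sdiff_subset ⟨hv, hvT⟩ ?_
  · exact this.2 hx
  · apply Clo.compl _ (hT.trans (cmpo_sub hv))
    intro a ha b hb hab
    exact hc a ha b (cmpo_clo a (hT ha) b hb hab) hab

theorem Cn.eq_of_clo {S T : Set V} (h : Cn G S) (hT : T ⊆ S) (hne : T.Nonempty)
    (hc : Clo G S T) : T = S := Set.Subset.antisymm hT (h.2 T hT hne hc)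

/-- Splitting a connected set off a vertex `c`: the component `K` of `S \ {c}` and the rest. -/
theorem cn_diff_cmpo {S : Set V} {c k : V} (hS : Cn G S) (hc : c ∈ S) (hk : k ∈ S \ {c}) :
    Cn G (S \ cmpo G (S \ {c}) k) := by
  have hKs := cmpo_sub (G := G) hk
  refine cn_of_root (b := c) ⟨hc, fun h => (hKs h).2 rfl⟩ ?_
  intro T hT hne hcl
  by_contra hcT
  have hTc : Clo G S T := by
    intro a ha b hb hab
    have haS := (hT ha).1
    have hac : a ≠ c := fun h => hcT (h ▸ ha)
    by_cases hbK : b ∈ cmpo G (S \ {c}) k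
    · exact absurd (cmpo_clo b hbK a ⟨haS, hac⟩ hab.symm) (hT ha).2
    · exact hcl a ha b ⟨hb, hbK⟩ hab
  exact hcT (hS.2 T (hT.trans Set.sdiff_subset) hne hTc hc)

/-- A connected set can be split into two connected parts separating two given vertices. -/
theorem exists_split {S : Set V} {l u : V} (hS : Cn G S) (hl : l ∈ S) (hu : u ∈ S)
    (hlu : l ≠ u) : ∃ T ⊆ S, u ∈ T ∧ l ∉ T ∧ Cn G T ∧ Cn G (S \ T) ∧ Tch G (S \ T) T := by
  have hu' : u ∈ S \ {l} := ⟨hu, fun h => hlu h.symm⟩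
  have hKs := cmpo_sub (G := G) hu'
  have hlT : l ∉ cmpo G (S \ {l}) u := fun h => (hKs h).2 rfl
  refine ⟨cmpo G (S \ {l}) u, hKs.trans Set.sdiff_subset, mem_cmpo, hlT, cmpo_cn hu',
    cn_diff_cmpo hS hl hu', ?_⟩
  by_contra hno
  refine hlT (hS.2 _ (hKs.trans Set.sdiff_subset) ⟨u, mem_cmpo⟩ ?_ hl)
  intro a ha b hb hab
  by_contra hbn
  exact hno ⟨b, ⟨hb, hbn⟩, a, ha, hab.symm⟩

end Basics

section STSection

variable {V : Type*} {G : SimpleGraph V}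

/-- An st-labelling of the vertex set `B` with respect to the pair `b₁, b₂`. -/
structure STLab (G : SimpleGraph V) (B : Set V) (b₁ b₂ : V) (g : V → ℤ) : Prop where
  fib : ∀ w ∈ B, Cn G {v | v ∈ B ∧ g v = g w}
  low : ∀ w ∈ B, g w ≠ g b₁ → ∃ v ∈ B, ∃ v' ∈ B, G.Adj v v' ∧ g v = g w ∧ g v' < g w
  high : ∀ w ∈ B, g w ≠ g b₂ → ∃ v ∈ B, ∃ v' ∈ B, G.Adj v v' ∧ g v = g w ∧ g w < g v'

theorem STLab.neg {B : Set V} {b₁ b₂ : V} {g : V → ℤ} (h : STLab G B b₁ b₂ g) :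
    STLab G B b₂ b₁ (fun v => - g v) := by
  refine ⟨fun w hw => ?_, fun w hw hn => ?_, fun w hw hn => ?_⟩
  · simpa using h.fib w hw
  · obtain ⟨v, hv, v', hv', a, b, c⟩ := h.high w hw (by simpa using hn)
    exact ⟨v, hv, v', hv', a, by simpa using b, by simpa using c⟩
  · obtain ⟨v, hv, v', hv', a, b, c⟩ := h.low w hw (by simpa using hn)
    exact ⟨v, hv, v', hv', a, by simpa using b, by simpa using c⟩

variable [Finite V]

theorem STLab.min_le {B : Set V} {b₁ b₂ : V} {g : V → ℤ} (h : STLab G B b₁ b₂ g) {w : V}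
    (hw : w ∈ B) : g b₁ ≤ g w := by
  obtain ⟨m, hm, hmin⟩ := Set.exists_min_image B g (Set.toFinite B) ⟨w, hw⟩
  by_cases hmb : g m = g b₁
  · rw [← hmb]; exact hmin w hw
  · obtain ⟨v, hv, v', hv', a, b, c⟩ := h.low m hm hmb
    exact absurd (hmin v' hv') (by omega)

theorem STLab.le_max {B : Set V} {b₁ b₂ : V} {g : V → ℤ} (h : STLab G B b₁ b₂ g) {w : V}
    (hw : w ∈ B) : g w ≤ g b₂ := by
  have := h.neg.min_le hw
  simpa using this

theorem STLab.initSeg {B : Set V} {b₁ b₂ : V} {g : V → ℤ} (h : STLab G B b₁ b₂ g) (hb : b₁ ∈ B)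
    {t : ℤ} (ht : g b₁ ≤ t) : Cn G {v | v ∈ B ∧ g v ≤ t} := by
  refine cn_of_root (b := b₁) ⟨hb, ht⟩ ?_
  intro T hT hne hc
  obtain ⟨m, hm, hmin⟩ := Set.exists_min_image T g (Set.toFinite T) hne
  have hmB := (hT hm).1
  have hmt : g m ≤ t := (hT hm).2
  have hfib : {v | v ∈ B ∧ g v = g m} ⊆ T :=
    (h.fib m hmB).sub_of_clo (fun v hv => And.intro hv.1 (by rw [hv.2]; exact hmt)) hc
      ⟨hmB, rfl⟩ hm
  by_cases hmb : g m = g b₁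
  · exact hfib ⟨hb, hmb.symm⟩
  · obtain ⟨v, hv, v', hv', a, b, c⟩ := h.low m hmB hmb
    have := hc v (hfib ⟨hv, b⟩) v' ⟨hv', by omega⟩ a
    exact absurd (hmin v' this) (by omega)

theorem STLab.tailSeg {B : Set V} {b₁ b₂ : V} {g : V → ℤ} (h : STLab G B b₁ b₂ g) (hb : b₂ ∈ B)
    {t : ℤ} (ht : t ≤ g b₂) : Cn G {v | v ∈ B ∧ t ≤ g v} := by
  have := h.neg.initSeg hb (t := -t) (by simpa using ht)
  simpa using this

/-- `N` is well linked to the pair `b₁, b₂` inside `B`. -/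
def Good (G : SimpleGraph V) (B : Set V) (b₁ b₂ : V) (N : Set V) : Prop :=
  ∀ y ∈ B, ∀ T ⊆ B \ {y}, Clo G (B \ {y}) T → (b₁ ∈ T ∨ b₂ ∈ T) → ∃ n ∈ T, n ∈ N

theorem STLab.refine {B : Set V} {b₁ b₂ : V} {g : V → ℤ} (h : STLab G B b₁ b₂ g)
    {l u : V} (hl : l ∈ B) (hu : u ∈ B) (hlu : l ≠ u) (hg : g l = g u)
    (hb₁ : b₁ ∈ B) (hb₂ : b₂ ∈ B)
    (hlow : l = b₁ ∨ (g l ≠ g b₁ ∧ ∃ v' ∈ B, G.Adj l v' ∧ g v' < g l))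
    (hhigh : u = b₂ ∨ (g u ≠ g b₂ ∧ ∃ v' ∈ B, G.Adj u v' ∧ g u < g v')) :
    ∃ gn, STLab G B b₁ b₂ gn ∧ (g '' B).ncard < (gn '' B).ncard := by
  classical
  obtain ⟨T, hTS, huT, hlT, hTc, hSTc, htch⟩ := exists_split (h.fib l hl)
    (l := l) (u := u) ⟨hl, rfl⟩ ⟨hu, hg.symm⟩ hlu
  set S := {v | v ∈ B ∧ g v = g l} with hS
  set gn : V → ℤ := fun v => 2 * g v + if v ∈ T then 1 else 0 with hg'
  have hgT : ∀ v ∈ T, gn v = 2 * g l + 1 := by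
    intro v hv
    have : g v = g l := (hTS hv).2
    simp [hg', hv, this]
  have hgn : ∀ v, v ∉ T → gn v = 2 * g v := by
    intro v hv; simp [hg', hv]
  have hcase : ∀ v, (v ∈ T ∧ gn v = 2 * g v + 1 ∧ g v = g l) ∨ (v ∉ T ∧ gn v = 2 * g v) := by
    intro v
    by_cases hv : v ∈ T
    · left; refine ⟨hv, ?_, (hTS hv).2⟩; simp [hg', hv]
    · right; exact ⟨hv, hgn v hv⟩
  obtain ⟨p, ⟨hpS, hpT⟩, q, hqT, hpq⟩ := htch
  have hgp : gn p = 2 * g l := by rw [hgn p hpT, hpS.2]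
  have hgq := hgT q hqT
  refine ⟨gn, ⟨?_, ?_, ?_⟩, ?_⟩
  · intro w hw
    rcases hcase w with ⟨hwT, hw1, hw2⟩ | ⟨hwT, hw1⟩
    · have : {v | v ∈ B ∧ gn v = gn w} = T := by
        ext v
        constructor
        · rintro ⟨hvB, hv⟩
          rcases hcase v with h1 | h1
          · exact h1.1
          · omega
        · intro hv
          exact ⟨(hTS hv).1, by rw [hgT v hv, hgT w hwT]⟩
      rw [this]; exact hTc
    · by_cases hwl : g w = g l
      · have : {v | v ∈ B ∧ gn v = gn w} = S \ T := by
          ext v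
          constructor
          · rintro ⟨hvB, hv⟩
            rcases hcase v with h1 | h1
            · omega
            · exact ⟨⟨hvB, by omega⟩, h1.1⟩
          · rintro ⟨⟨hvB, hv⟩, hvT⟩
            exact ⟨hvB, by rw [hgn v hvT, hw1]; omega⟩
        rw [this]; exact hSTc
      · have : {v | v ∈ B ∧ gn v = gn w} = {v | v ∈ B ∧ g v = g w} := by
          ext v
          constructor
          · rintro ⟨hvB, hv⟩
            rcases hcase v with h1 | h1
            · omega
            · exact ⟨hvB, by omega⟩
          · rintro ⟨hvB, hv⟩
            rcases hcase v with h1 | h1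
            · omega
            · exact ⟨hvB, by omega⟩
        rw [this]; exact h.fib w hw
  · intro w hw hne
    rcases hcase w with ⟨hwT, hw1, hw2⟩ | ⟨hwT, hw1⟩
    · exact ⟨q, (hTS hqT).1, p, hpS.1, hpq.symm, by omega, by omega⟩
    · by_cases hwl : g w = g l
      · rcases hlow with rfl | ⟨h0, v', hv', hadj, hlt⟩
        · exact absurd (by rw [hw1, hgn l hlT, hwl]) hne
        · refine ⟨l, hl, v', hv', hadj, by rw [hgn l hlT]; omega, ?_⟩
          rcases hcase v' with h1 | h1 <;> omega
      · have hwb : g w ≠ g b₁ := by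
          intro h0
          rcases hcase b₁ with h1 | h1 <;> omega
        obtain ⟨v, hv, v', hv', a, b, c⟩ := h.low w hw hwb
        refine ⟨v, hv, v', hv', a, ?_, ?_⟩
        · rcases hcase v with h1 | h1 <;> omega
        · rcases hcase v' with h1 | h1 <;> omega
  · intro w hw hne
    rcases hcase w with ⟨hwT, hw1, hw2⟩ | ⟨hwT, hw1⟩
    · rcases hhigh with rfl | ⟨h0, v', hv', hadj, hlt⟩
      · exact absurd (by rw [hgT w hwT, hgT u huT]) hne
      · refine ⟨u, hu, v', hv', hadj, by rw [hgT u huT]; omega, ?_⟩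
        rcases hcase v' with h1 | h1 <;> omega
    · by_cases hwl : g w = g l
      · exact ⟨p, hpS.1, q, (hTS hqT).1, hpq, by omega, by omega⟩
      · have hwb : g w ≠ g b₂ := by
          intro h0
          rcases hcase b₂ with h1 | h1 <;> omega
        obtain ⟨v, hv, v', hv', a, b, c⟩ := h.high w hw hwb
        refine ⟨v, hv, v', hv', a, ?_, ?_⟩
        · rcases hcase v with h1 | h1 <;> omega
        · rcases hcase v' with h1 | h1 <;> omega
  · have himg : g '' B = (fun z : ℤ => z / 2) '' (gn '' B) := by
      rw [Set.image_image]
      apply Set.image_congr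
      intro v _
      rcases hcase v with h1 | h1 <;> omega
    have hle : (g '' B).ncard ≤ (gn '' B).ncard := by
      rw [himg]; exact Set.ncard_image_le (Set.toFinite _)
    refine lt_of_le_of_ne hle fun heq => ?_
    rw [himg] at heq
    have hinj := (Set.ncard_image_iff (Set.toFinite _)).1 heq
    have h1 := hinj (Set.mem_image_of_mem gn hpS.1) (Set.mem_image_of_mem gn (hTS hqT).1)
      (by show gn p / 2 = gn q / 2; omega)
    omega

/-- A finest st-labelling separates every well-linked set. -/
theorem exists_STLab {B : Set V} {b₁ b₂ : V} (hB : Cn G B) (hb₁ : b₁ ∈ B) (hb₂ : b₂ ∈ B)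
    (hne : b₁ ≠ b₂) : ∃ g, STLab G B b₁ b₂ g ∧ ∀ N, Good G B b₁ b₂ N →
      ∃ p ∈ B, ∃ q ∈ B, p ∈ N ∧ q ∈ N ∧ g p < g q := by
  classical
  have h0 : ∃ n, ∃ g, STLab G B b₁ b₂ g ∧ B.ncard - (g '' B).ncard = n := by
    refine ⟨_, fun _ => 0, ⟨?_, ?_, ?_⟩, rfl⟩
    · intro w _; simpa using hB
    · intro w _ h; exact absurd rfl h
    · intro w _ h; exact absurd rfl h
  obtain ⟨g, hg, hgn⟩ := Nat.find_spec h0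
  have hmax : ∀ gn, STLab G B b₁ b₂ gn → ¬ (g '' B).ncard < (gn '' B).ncard := by
    intro gn hg' hlt
    have h1 : (gn '' B).ncard ≤ B.ncard := Set.ncard_image_le (Set.toFinite _)
    exact Nat.find_min h0 (m := B.ncard - (gn '' B).ncard) (by omega) ⟨gn, hg', rfl⟩
  refine ⟨g, hg, fun N hN => ?_⟩
  by_contra hcon
  push Not at hcon
  obtain ⟨n, hnT, hnN⟩ := hN b₁ hb₁ (B \ {b₁}) subset_rfl (fun _ _ _ hb _ => hb)
    (Or.inr ⟨hb₂, fun h => hne h.symm⟩)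
  have hnB := hnT.1
  have hall : ∀ m ∈ B, m ∈ N → g m = g n := fun m hm hmN =>
    le_antisymm (hcon n hnB m hm hnN hmN) (hcon m hm n hnB hmN hnN)
  let Lw : V → Prop := fun l => l = b₁ ∨ (g l ≠ g b₁ ∧ ∃ v' ∈ B, G.Adj l v' ∧ g v' < g l)
  let Up : V → Prop := fun u => u = b₂ ∨ (g u ≠ g b₂ ∧ ∃ v' ∈ B, G.Adj u v' ∧ g u < g v')
  have hkey : ∀ l ∈ B, ∀ u ∈ B, g l = g u → Lw l → Up u → l = u := by
    intro l hl u hu hlu h1 h2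
    by_contra hne'
    obtain ⟨gn, hg', hlt⟩ := hg.refine hl hu hne' hlu hb₁ hb₂ h1 h2
    exact hmax gn hg' hlt
  have hL : ∃ l ∈ B, g l = g n ∧ Lw l := by
    by_cases h : g n = g b₁
    · exact ⟨b₁, hb₁, h.symm, Or.inl rfl⟩
    · obtain ⟨v, hv, v', hv', a, b, c⟩ := hg.low n hnB h
      exact ⟨v, hv, b, Or.inr ⟨b ▸ h, v', hv', a, b ▸ c⟩⟩
  have hU : ∃ l ∈ B, g l = g n ∧ Up l := by
    by_cases h : g n = g b₂
    · exact ⟨b₂, hb₂, h.symm, Or.inl rfl⟩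
    · obtain ⟨v, hv, v', hv', a, b, c⟩ := hg.high n hnB h
      exact ⟨v, hv, b, Or.inr ⟨b ▸ h, v', hv', a, b ▸ c⟩⟩
  obtain ⟨c, hcB, hcn, hcL⟩ := hL
  obtain ⟨c', hcB', hcn', hcU⟩ := hU
  have hcc : c = c' := hkey c hcB c' hcB' (by omega) hcL hcU
  subst hcc
  have honly : ∀ v ∈ B, g v = g n → (Lw v ∨ Up v) → v = c := by
    rintro v hv hvn (h1 | h1)
    · exact hkey v hv c hcB (by omega) h1 hcU
    · exact (hkey c hcB v hv (by omega) hcL h1).symm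
  have h1 : Clo G (B \ {c}) {v | v ∈ B ∧ g v ≠ g n} := by
    intro a ha b hb hab
    refine ⟨hb.1, fun hbn => hb.2 ?_⟩
    apply honly b hb.1 hbn
    have hge := hg.min_le ha.1
    have hle := hg.le_max ha.1
    rcases lt_or_gt_of_ne ha.2 with h1 | h1
    · left; right
      exact ⟨by omega, a, ha.1, hab.symm, by omega⟩
    · right; right
      exact ⟨by omega, a, ha.1, hab.symm, by omega⟩
  have h2 : b₁ ∈ {v | v ∈ B ∧ g v ≠ g n} ∨ b₂ ∈ {v | v ∈ B ∧ g v ≠ g n} := by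
    by_contra hno
    push Not at hno
    have h1 : g b₁ = g n := by by_contra h; exact hno.1 ⟨hb₁, h⟩
    have h2 : g b₂ = g n := by by_contra h; exact hno.2 ⟨hb₂, h⟩
    exact hne ((honly b₁ hb₁ h1 (Or.inl (Or.inl rfl))).trans
      (honly b₂ hb₂ h2 (Or.inr (Or.inl rfl))).symm)
  obtain ⟨m, hm, hmN⟩ := hN c hcB {v | v ∈ B ∧ g v ≠ g n}
    (fun v hv => ⟨hv.1, fun h => hv.2 (by rw [h]; exact hcn)⟩) h1 h2
  exact hm.2 (hall m hm.1 hmN)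

end STSection

section Minors

theorem mem_map_image_iff {V W : Type*} (f : V → W) (Z : Set (Sym2 V)) (a b : W) :
    s(a, b) ∈ Sym2.map f '' Z ↔ ∃ x y, s(x, y) ∈ Z ∧ f x = a ∧ f y = b := by
  constructor
  · rintro ⟨e, he, hab⟩
    induction e using Sym2.ind with
    | _ x y =>
      rw [Sym2.map_mk, Sym2.eq_iff] at hab
      rcases hab with ⟨h1, h2⟩ | ⟨h1, h2⟩
      · exact ⟨x, y, he, h1, h2⟩
      · exact ⟨y, x, by rwa [Sym2.eq_swap], h2, h1⟩
  · rintro ⟨x, y, h, rfl, rfl⟩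
    exact ⟨s(x, y), h, rfl⟩

theorem contract_adj (C : CGraph) {u v : C.V} (huv : u ≠ v) (a b : {w : C.V // w ≠ v}) :
    (C.contract u v huv).G.Adj a b ↔
      a ≠ b ∧ ∃ x y, C.G.Adj x y ∧ contractFun huv x = a ∧ contractFun huv y = b := by
  show (fromEdgeSet (Sym2.map (contractFun huv) '' C.G.edgeSet)).Adj a b ↔ _
  rw [fromEdgeSet_adj, mem_map_image_iff]
  simp only [mem_edgeSet]
  tauto

theorem contract_X (C : CGraph) {u v : C.V} (huv : u ≠ v) (a b : {w : C.V // w ≠ v}) :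
    s(a, b) ∈ (C.contract u v huv).X ↔
      a ≠ b ∧ ∃ x y, s(x, y) ∈ C.X ∧ contractFun huv x = a ∧ contractFun huv y = b := by
  show (s(a, b) ∈ Sym2.map (contractFun huv) '' C.X ∧ ¬ s(a, b).IsDiag) ↔ _
  rw [mem_map_image_iff, Sym2.mk_isDiag_iff]
  tauto

theorem contract_WF (C : CGraph) (hC : C.WF) {u v : C.V} (huv : u ≠ v) :
    (C.contract u v huv).WF := by
  intro e
  induction e using Sym2.ind with
  | _ a b =>
    intro h
    obtain ⟨hne, x, y, h, h1, h2⟩ := (contract_X C huv a b).1 h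
    exact (contract_adj C huv a b).2 ⟨hne, x, y, hC h, h1, h2⟩

theorem contractFun_self {V : Type*} {u v : V} (huv : u ≠ v) (w : {w : V // w ≠ v}) :
    contractFun huv w.1 = w := by
  unfold contractFun
  rw [dif_neg w.2]

theorem contractFun_comp {V U : Type*} {u v : V} (huv : u ≠ v) (p : V → U) (hp : p u = p v)
    (x : V) : p (contractFun huv x).1 = p x := by
  unfold contractFun
  by_cases h : x = v
  · rw [dif_pos h, h]; exact hp
  · rw [dif_neg h]

theorem quot_minor (n : ℕ) : ∀ (C : CGraph), C.WF → ∀ {U : Type} (p : C.V → U),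
    Nat.card C.V = n → Function.Surjective p → (∀ u, Cn C.G {x | p x = u}) →
    ∃ D : CGraph, IsCMinor C D ∧ ∃ φ : D.V ≃ U,
      (∀ a b, D.G.Adj a b ↔ φ a ≠ φ b ∧ ∃ x y, C.G.Adj x y ∧ p x = φ a ∧ p y = φ b) ∧
      (∀ a b, s(a, b) ∈ D.X ↔ φ a ≠ φ b ∧ ∃ x y, s(x, y) ∈ C.X ∧ p x = φ a ∧ p y = φ b) := by
  induction n using Nat.strong_induction_on with
  | _ n ih =>
    intro C hC U p hn hs hcn
    by_cases hinj : Function.Injective p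
    · refine ⟨C, Relation.ReflTransGen.refl, Equiv.ofBijective p (show Function.Bijective p from ⟨hinj, hs⟩),
        ?_, ?_⟩
      · intro a b
        simp only [Equiv.ofBijective_apply]
        constructor
        · intro h
          exact ⟨fun h' => h.ne (hinj h'), a, b, h, rfl, rfl⟩
        · rintro ⟨_, x, y, h, h1, h2⟩
          rw [← hinj h1, ← hinj h2]; exact h
      · intro a b
        simp only [Equiv.ofBijective_apply]
        constructor
        · intro h
          have h' : C.G.Adj a b := hC h
          exact ⟨fun h'' => h'.ne (hinj h''), a, b, h, rfl, rfl⟩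
        · rintro ⟨_, x, y, h, h1, h2⟩
          rw [← hinj h1, ← hinj h2]; exact h
    · have : ∃ u v, C.G.Adj u v ∧ p u = p v := by
        unfold Function.Injective at hinj
        push Not at hinj
        obtain ⟨x, y, hxy, hne⟩ := hinj
        by_contra hno
        push Not at hno
        have := (hcn (p y)).2 {x} (by rintro z rfl; exact hxy) ⟨x, rfl⟩ (by
          rintro a rfl b hb hab
          exact absurd (hxy.trans hb.symm) (hno _ _ hab))
        exact hne (this rfl).symm
      obtain ⟨u, v, huv, hp⟩ := this
      have hne := huv.ne
      let C' := C.contract u v hne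
      let p' : C'.V → U := fun w => p w.1
      have hcomp : ∀ x, p' (contractFun hne x) = p x := contractFun_comp hne p hp
      have hcard : Nat.card C'.V < n := by
        rw [← hn]
        exact Finite.card_subtype_lt (p := fun w => w ≠ v) (x := v) (by simp)
      have hs1 : Function.Surjective p' := by
        intro w
        obtain ⟨x, rfl⟩ := hs w
        exact ⟨contractFun hne x, hcomp x⟩
      have hs2 : ∀ w, Cn C'.G {x | p' x = w} := by
        intro w
        obtain ⟨⟨x, hx⟩, hc⟩ := hcn w
        refine ⟨⟨contractFun hne x, (hcomp x).trans hx⟩, ?_⟩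
        intro T hT hTne hcl
        let cf : C.V → C'.V := contractFun hne
        have hself : ∀ z : C'.V, cf z.1 = z := contractFun_self hne
        have h1 : ({x | cf x ∈ T} : Set C.V).Nonempty := by
          obtain ⟨t, ht⟩ := hTne
          exact ⟨t.1, show cf t.1 ∈ T by rw [hself]; exact ht⟩
        have h2 : Clo C.G {x | p x = w} {x | cf x ∈ T} := by
          intro a ha b hb hab
          show cf b ∈ T
          by_cases h : cf a = cf b
          · rw [← h]; exact ha
          · exact hcl _ ha _ ((hcomp b).trans hb)
              ((contract_adj C hne _ _).2 ⟨h, a, b, hab, rfl, rfl⟩)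
        have h3 := hc {x | cf x ∈ T} (fun z hz => (hcomp z).symm.trans (hT hz)) h1 h2
        intro z hz
        have h4 : cf z.1 ∈ T := h3 (show z.1 ∈ {x | p x = w} from hz)
        rw [hself] at h4
        exact h4
      obtain ⟨D, hD, φ, hG, hX⟩ := ih _ hcard C' (contract_WF C hC hne) p' rfl hs1 hs2
      refine ⟨D, Relation.ReflTransGen.head (CMinorStep.contr C u v huv) hD, φ, ?_, ?_⟩
      · intro a b
        rw [hG]
        refine and_congr_right fun hab => ?_
        constructor
        · rintro ⟨x, y, h, h1, h2⟩
          obtain ⟨_, x', y', h', rfl, rfl⟩ := (contract_adj C hne x y).1 h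
          exact ⟨x', y', h', by rw [← h1, hcomp], by rw [← h2, hcomp]⟩
        · rintro ⟨x, y, h, h1, h2⟩
          refine ⟨contractFun hne x, contractFun hne y, ?_, by rw [hcomp, h1],
            by rw [hcomp, h2]⟩
          refine (contract_adj C hne _ _).2 ⟨fun h' => hab ?_, x, y, h, rfl, rfl⟩
          rw [← h1, ← h2, ← hcomp, h', hcomp]
      · intro a b
        rw [hX]
        refine and_congr_right fun hab => ?_
        constructor
        · rintro ⟨x, y, h, h1, h2⟩
          obtain ⟨_, x', y', h', rfl, rfl⟩ := (contract_X C hne x y).1 h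
          exact ⟨x', y', h', by rw [← h1, hcomp], by rw [← h2, hcomp]⟩
        · rintro ⟨x, y, h, h1, h2⟩
          refine ⟨contractFun hne x, contractFun hne y, ?_, by rw [hcomp, h1],
            by rw [hcomp, h2]⟩
          refine (contract_X C hne _ _).2 ⟨fun h' => hab ?_, x, y, h, rfl, rfl⟩
          rw [← h1, ← h2, ← hcomp, h', hcomp]

theorem del_minor (n : ℕ) : ∀ (C : CGraph) (H : SimpleGraph C.V), H ≤ C.G → C.X ⊆ H.edgeSet →
    (C.G.edgeSet \ H.edgeSet).ncard = n → IsCMinor C ⟨C.V, H, C.X, C.fin⟩ := by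
  induction n with
  | zero =>
    intro C H hle hX hn
    rw [Set.ncard_eq_zero (Set.toFinite _), Set.sdiff_eq_empty, edgeSet_subset_edgeSet] at hn
    have : H = C.G := le_antisymm hle hn
    subst this
    exact Relation.ReflTransGen.refl
  | succ n ih =>
    intro C H hle hX hn
    have hne : (C.G.edgeSet \ H.edgeSet).Nonempty := by
      rw [← Set.ncard_pos (Set.toFinite _)]; omega
    obtain ⟨e, he, heH⟩ := hne
    refine Relation.ReflTransGen.head (CMinorStep.del C e he (fun h => heH (hX h))) ?_
    refine ih (C.deleteEdge e) H ?_ hX ?_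
    · intro a b hab
      refine deleteEdges_adj.2 ⟨hle hab, fun h => heH ?_⟩
      rw [← Set.mem_singleton_iff.1 h]; exact hab
    · show ((C.G.deleteEdges {e}).edgeSet \ H.edgeSet).ncard = n
      have h1 : (C.G.deleteEdges {e}).edgeSet \ H.edgeSet = (C.G.edgeSet \ H.edgeSet) \ {e} := by
        rw [edgeSet_deleteEdges]
        ext x
        simp only [Set.mem_sdiff]
        tauto
      rw [h1, Set.ncard_sdiff_singleton_of_mem (show e ∈ C.G.edgeSet \ H.edgeSet from ⟨he, heH⟩), hn]
      rfl

/-- Some edge of `X` joins `S` to `T`. -/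
def XT {V : Type*} (X : Set (Sym2 V)) (S T : Set V) : Prop := ∃ a ∈ S, ∃ b ∈ T, s(a, b) ∈ X

theorem XT.symm {V : Type*} {X : Set (Sym2 V)} {S T : Set V} (h : XT X S T) : XT X T S := by
  obtain ⟨a, ha, b, hb, hab⟩ := h
  exact ⟨b, hb, a, ha, by rwa [Sym2.eq_swap]⟩

theorem XT.mono {V : Type*} {X : Set (Sym2 V)} {S T S' T' : Set V} (h : XT X S T)
    (hS : S ⊆ S') (hT : T ⊆ T') : XT X S' T' := by
  obtain ⟨a, ha, b, hb, hab⟩ := h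
  exact ⟨a, hS ha, b, hT hb, hab⟩

theorem minor_of_parts (C : CGraph) (hC : C.WF) {n : ℕ} (S : Fin n → Set C.V)
    (hcov : ∀ x, ∃ i, x ∈ S i) (hdis : ∀ i j x, x ∈ S i → x ∈ S j → i = j)
    (hcn : ∀ i, Cn C.G (S i)) (H : SimpleGraph (Fin n)) (Y : Set (Sym2 (Fin n)))
    (hH : ∀ a b, H.Adj a b → Tch C.G (S a) (S b))
    (hX : ∀ a b, a ≠ b → (s(a, b) ∈ Y ↔ XT C.X (S a) (S b)))
    (hYH : Y ⊆ H.edgeSet) :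
    ∃ D, IsCMinor C D ∧ CGIso D (CGraph.mk (Fin n) H Y) := by
  choose p hp using hcov
  have hpi : ∀ x i, p x = i ↔ x ∈ S i := fun x i =>
    ⟨fun h => h ▸ hp x, fun h => hdis _ _ x (hp x) h⟩
  have hs : Function.Surjective p := by
    intro i
    obtain ⟨x, hx⟩ := (hcn i).1
    exact ⟨x, (hpi x i).2 hx⟩
  obtain ⟨D, hD, φ, hDG, hDX⟩ := quot_minor _ C hC p rfl hs (by
    intro i
    have : {x | p x = i} = S i := by ext x; exact hpi x i
    rw [this]; exact hcn i)
  let H' : SimpleGraph D.V := H.comap φ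
  have hDXiff : ∀ a b, s(a, b) ∈ D.X ↔ s(φ a, φ b) ∈ Y := by
    intro a b
    rw [hDX]
    constructor
    · rintro ⟨hne, x, y, h, h1, h2⟩
      exact (hX _ _ hne).2 ⟨x, (hpi _ _).1 h1, y, (hpi _ _).1 h2, h⟩
    · intro h
      have hne : φ a ≠ φ b := by
        have : H.Adj (φ a) (φ b) := hYH h
        exact this.ne
      obtain ⟨x, hx, y, hy, h⟩ := (hX _ _ hne).1 h
      exact ⟨hne, x, y, h, (hpi _ _).2 hx, (hpi _ _).2 hy⟩
  have hle : H' ≤ D.G := by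
    intro a b hab
    have hab' : H.Adj (φ a) (φ b) := hab
    obtain ⟨x, hx, y, hy, h⟩ := hH _ _ hab'
    exact (hDG a b).2 ⟨hab'.ne, x, y, h, (hpi _ _).2 hx, (hpi _ _).2 hy⟩
  have hXH : D.X ⊆ H'.edgeSet := by
    intro e
    induction e using Sym2.ind with
    | _ a b =>
      intro h
      have : H.Adj (φ a) (φ b) := hYH ((hDXiff a b).1 h)
      exact this
  refine ⟨⟨D.V, H', D.X, D.fin⟩, hD.trans (del_minor _ D H' hle hXH rfl), ?_⟩
  refine ⟨⟨φ, Iff.rfl⟩, ?_⟩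
  ext e
  induction e using Sym2.ind with
  | _ a b =>
    show s(a, b) ∈ Sym2.map φ '' D.X ↔ s(a, b) ∈ Y
    rw [mem_map_image_iff]
    constructor
    · rintro ⟨x, y, h, rfl, rfl⟩
      exact (hDXiff x y).1 h
    · intro h
      refine ⟨φ.symm a, φ.symm b, ?_, by simp, by simp⟩
      rw [hDXiff]; simpa using h

/-- `C` has an obstruction as a constraint minor. -/
def HasObs (C : CGraph) : Prop := ∃ D, IsCMinor C D ∧ IsObstruction D

end Minors

section Obstructions

theorem obs_K4 (C : CGraph) (hC : C.WF) (A S0 S1 S2 S3 : Set C.V)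
    (hA : ∀ x, x ∈ A ↔ (x ∈ S0 ∨ x ∈ S1)) (hA' : ∀ x, x ∉ A ↔ (x ∈ S2 ∨ x ∈ S3))
    (d01 : ∀ x ∈ S0, x ∉ S1) (d23 : ∀ x ∈ S2, x ∉ S3)
    (c0 : Cn C.G S0) (c1 : Cn C.G S1) (c2 : Cn C.G S2) (c3 : Cn C.G S3)
    (hsep : ∀ x y, s(x, y) ∈ C.X → (x ∈ A ↔ y ∈ A))
    (x01 : XT C.X S0 S1) (x23 : XT C.X S2 S3)
    (t02 : Tch C.G S0 S2) (t03 : Tch C.G S0 S3) (t12 : Tch C.G S1 S2) (t13 : Tch C.G S1 S3) :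
    HasObs C := by
  have t01 : Tch C.G S0 S1 := by
    obtain ⟨a, ha, b, hb, h⟩ := x01; exact ⟨a, ha, b, hb, hC h⟩
  have t23 : Tch C.G S2 S3 := by
    obtain ⟨a, ha, b, hb, h⟩ := x23; exact ⟨a, ha, b, hb, hC h⟩
  have hno : ∀ S T : Set C.V, S ⊆ A → T ⊆ Aᶜ → ¬ XT C.X S T := by
    rintro S T hS hT ⟨a, ha, b, hb, h⟩
    exact hT hb ((hsep a b h).1 (hS ha))
  have s0 : S0 ⊆ A := fun x hx => (hA x).2 (Or.inl hx)
  have s1 : S1 ⊆ A := fun x hx => (hA x).2 (Or.inr hx)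
  have s2 : S2 ⊆ Aᶜ := fun x hx => (hA' x).2 (Or.inl hx)
  have s3 : S3 ⊆ Aᶜ := fun x hx => (hA' x).2 (Or.inr hx)
  have n02 := hno _ _ s0 s2
  have n03 := hno _ _ s0 s3
  have n12 := hno _ _ s1 s2
  have n13 := hno _ _ s1 s3
  obtain ⟨D, h1, h2⟩ := minor_of_parts C hC ![S0, S1, S2, S3] (by
      intro x
      by_cases h : x ∈ A
      · rcases (hA x).1 h with h | h
        · exact ⟨0, h⟩
        · exact ⟨1, h⟩
      · rcases (hA' x).1 h with h | h
        · exact ⟨2, h⟩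
        · exact ⟨3, h⟩) (by
      intro i j x hi hj
      have e1 := hA x
      have e2 := hA' x
      have e3 := d01 x
      have e4 := d23 x
      fin_cases i <;> fin_cases j <;> simp at hi hj ⊢ <;> tauto) (by
      intro i
      fin_cases i <;> assumption) ⊤ {s(0, 1), s(2, 3)} (by
      intro i j hij
      rw [top_adj] at hij
      fin_cases i <;> fin_cases j <;> first | exact absurd rfl hij | assumption |
        (apply Tch.symm; assumption)) (by
      intro i j hij
      have x10 := x01.symm
      have x32 := x23.symm
      have n20 := fun h => n02 (XT.symm h)
      have n30 := fun h => n03 (XT.symm h)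
      have n21 := fun h => n12 (XT.symm h)
      have n31 := fun h => n13 (XT.symm h)
      fin_cases i <;> fin_cases j <;> first | exact absurd rfl hij | (simp; assumption)) (by
      rintro e (rfl | rfl) <;> simp)
  exact ⟨D, h1, Or.inl h2⟩

theorem obs_wheel (C : CGraph) (hC : C.WF) (S0 S1 S2 S3 H : Set C.V)
    (hcov : ∀ x, x ∈ S0 ∨ x ∈ S1 ∨ x ∈ S2 ∨ x ∈ S3 ∨ x ∈ H)
    (d0 : ∀ x ∈ S0, x ∉ S1 ∧ x ∉ S2 ∧ x ∉ S3 ∧ x ∉ H) (d1 : ∀ x ∈ S1, x ∉ S2 ∧ x ∉ S3 ∧ x ∉ H)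
    (d2 : ∀ x ∈ S2, x ∉ S3 ∧ x ∉ H) (d3 : ∀ x ∈ S3, x ∉ H)
    (c0 : Cn C.G S0) (c1 : Cn C.G S1) (c2 : Cn C.G S2) (c3 : Cn C.G S3) (c4 : Cn C.G H)
    (x01 : XT C.X S0 S1) (x23 : XT C.X S2 S3)
    (n02 : ¬ XT C.X S0 S2) (n03 : ¬ XT C.X S0 S3) (n12 : ¬ XT C.X S1 S2) (n13 : ¬ XT C.X S1 S3)
    (n04 : ¬ XT C.X S0 H) (n14 : ¬ XT C.X S1 H) (n24 : ¬ XT C.X S2 H) (n34 : ¬ XT C.X S3 H)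
    (t12 : Tch C.G S1 S2) (t03 : Tch C.G S0 S3) (t04 : Tch C.G S0 H) (t14 : Tch C.G S1 H)
    (t24 : Tch C.G S2 H) (t34 : Tch C.G S3 H) :
    HasObs C := by
  have t01 : Tch C.G S0 S1 := by
    obtain ⟨a, ha, b, hb, h⟩ := x01; exact ⟨a, ha, b, hb, hC h⟩
  have t23 : Tch C.G S2 S3 := by
    obtain ⟨a, ha, b, hb, h⟩ := x23; exact ⟨a, ha, b, hb, hC h⟩
  have hSi : ∀ (i : Fin 5) x, x ∈ (![S0, S1, S2, S3, H] : Fin 5 → Set C.V) i → (i = 0 ∧ x ∈ S0) ∨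
      (i = 1 ∧ x ∈ S1) ∨ (i = 2 ∧ x ∈ S2) ∨ (i = 3 ∧ x ∈ S3) ∨ (i = 4 ∧ x ∈ H) := by
    intro i x hx
    match i, hx with
    | 0, hx => exact Or.inl ⟨rfl, hx⟩
    | 1, hx => exact Or.inr (Or.inl ⟨rfl, hx⟩)
    | 2, hx => exact Or.inr (Or.inr (Or.inl ⟨rfl, hx⟩))
    | 3, hx => exact Or.inr (Or.inr (Or.inr (Or.inl ⟨rfl, hx⟩)))
    | 4, hx => exact Or.inr (Or.inr (Or.inr (Or.inr ⟨rfl, hx⟩)))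
  obtain ⟨D, h1, h2⟩ := minor_of_parts C hC ![S0, S1, S2, S3, H] (by
      intro x
      rcases hcov x with h | h | h | h | h
      · exact ⟨0, h⟩
      · exact ⟨1, h⟩
      · exact ⟨2, h⟩
      · exact ⟨3, h⟩
      · exact ⟨4, h⟩) (by
      intro i j x hi hj
      have e0 := d0 x
      have e1 := d1 x
      have e2 := d2 x
      have e3 := d3 x
      have e6 := hSi i x hi
      have e7 := hSi j x hj
      clear * - e0 e1 e2 e3 e6 e7
      grind) (by
      intro i
      fin_cases i <;> assumption) wheelGraph {s(0, 1), s(2, 3)} (by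
      intro i j hij
      have hij' : i ≠ j := hij.ne
      unfold wheelGraph at hij
      rw [fromEdgeSet_adj] at hij
      fin_cases i <;> fin_cases j <;> first
        | exact absurd rfl hij'
        | assumption
        | (apply Tch.symm; assumption)
        | (simp at hij)) (by
      intro i j hij
      have x10 := x01.symm
      have x32 := x23.symm
      have n20 := fun h => n02 (XT.symm h)
      have n30 := fun h => n03 (XT.symm h)
      have n21 := fun h => n12 (XT.symm h)
      have n31 := fun h => n13 (XT.symm h)
      have n40 := fun h => n04 (XT.symm h)
      have n41 := fun h => n14 (XT.symm h)
      have n42 := fun h => n24 (XT.symm h)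
      have n43 := fun h => n34 (XT.symm h)
      fin_cases i <;> fin_cases j <;> first | exact absurd rfl hij | (simp; assumption)) (by
      unfold wheelGraph
      rintro e (rfl | rfl) <;> simp)
  exact ⟨D, h1, Or.inr (Or.inl h2)⟩

theorem tri_connected {V : Type*} {a b c : V} (hab : a ≠ b) (hbc : b ≠ c)
    (Z : Set (Sym2 V)) (h1 : s(a, b) ∈ Z) (h2 : s(b, c) ∈ Z)
    (hZ : ∀ e ∈ Z, ∀ x ∈ e, x = a ∨ x = b ∨ x = c) :
    EdgeSetConnected Z ∧ (fromEdgeSet Z).support = {a, b, c} := by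
  have a1 : (fromEdgeSet Z).Adj a b := by rw [fromEdgeSet_adj]; exact ⟨h1, hab⟩
  have a2 : (fromEdgeSet Z).Adj b c := by rw [fromEdgeSet_adj]; exact ⟨h2, hbc⟩
  have hsub : ∀ x ∈ (fromEdgeSet Z).support, x = a ∨ x = b ∨ x = c := by
    intro x hx
    obtain ⟨y, hy⟩ := (mem_support _).1 hx
    rw [fromEdgeSet_adj] at hy
    exact hZ _ hy.1 x (Sym2.mem_mk_left x y)
  have hr : ∀ x ∈ (fromEdgeSet Z).support, (fromEdgeSet Z).Reachable x b := by
    intro x hx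
    rcases hsub x hx with rfl | rfl | rfl
    · exact a1.reachable
    · exact Reachable.refl _
    · exact a2.symm.reachable
  refine ⟨fun u hu v hv => (hr u hu).trans (hr v hv).symm, ?_⟩
  ext x
  constructor
  · exact hsub x
  · rintro (rfl | rfl | rfl)
    · exact ⟨_, a1⟩
    · exact ⟨_, a2⟩
    · exact ⟨_, a2.symm⟩

theorem two_of_three {p q r : Prop} (h0 : p ∨ r) (h1 : p ∨ q) (h2 : q ∨ r) :
    (p ∧ q) ∨ (q ∧ r) ∨ (p ∧ r) := by tauto

theorem tri_cover {V : Type*} {a b c : V} (hab : a ≠ b) (hbc : b ≠ c) (hac : a ≠ c)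
    (Z : Set (Sym2 V)) (h0 : s(a, b) ∈ Z ∨ s(a, c) ∈ Z) (h1 : s(a, b) ∈ Z ∨ s(b, c) ∈ Z)
    (h2 : s(b, c) ∈ Z ∨ s(a, c) ∈ Z)
    (hZ : ∀ e ∈ Z, ∀ x ∈ e, x = a ∨ x = b ∨ x = c) :
    EdgeSetConnected Z ∧ (fromEdgeSet Z).support = {a, b, c} := by
  rcases two_of_three h0 h1 h2 with ⟨p, q⟩ | ⟨p, q⟩ | ⟨p, q⟩
  · exact tri_connected hab hbc Z p q hZ
  · rw [Sym2.eq_swap] at q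
    have := tri_connected hbc hac.symm Z p q (fun e he x hx => by have := hZ e he x hx; tauto)
    refine ⟨this.1, this.2.trans ?_⟩
    ext x; simp only [Set.mem_insert_iff, Set.mem_singleton_iff]; tauto
  · rw [Sym2.eq_swap] at p
    have := tri_connected hab.symm hac Z p q (fun e he x hx => by have := hZ e he x hx; tauto)
    refine ⟨this.1, this.2.trans ?_⟩
    ext x; simp only [Set.mem_insert_iff, Set.mem_singleton_iff]; tauto

theorem obs_prism (C : CGraph) (hC : C.WF) (A P0 P1 P2 Q0 Q1 Q2 : Set C.V)
    (hA : ∀ x, x ∈ A ↔ (x ∈ P0 ∨ x ∈ P1 ∨ x ∈ P2)) (hA' : ∀ x, x ∉ A ↔ (x ∈ Q0 ∨ x ∈ Q1 ∨ x ∈ Q2))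
    (d0 : ∀ x ∈ P0, x ∉ P1 ∧ x ∉ P2) (d1 : ∀ x ∈ P1, x ∉ P2)
    (d2 : ∀ x ∈ Q0, x ∉ Q1 ∧ x ∉ Q2) (d3 : ∀ x ∈ Q1, x ∉ Q2)
    (c0 : Cn C.G P0) (c1 : Cn C.G P1) (c2 : Cn C.G P2)
    (c3 : Cn C.G Q0) (c4 : Cn C.G Q1) (c5 : Cn C.G Q2)
    (hsep : ∀ x y, s(x, y) ∈ C.X → (x ∈ A ↔ y ∈ A))
    (t01 : Tch C.G P0 P1) (t12 : Tch C.G P1 P2) (t02 : Tch C.G P0 P2)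
    (t34 : Tch C.G Q0 Q1) (t45 : Tch C.G Q1 Q2) (t35 : Tch C.G Q0 Q2)
    (t03 : Tch C.G P0 Q0) (t14 : Tch C.G P1 Q1) (t25 : Tch C.G P2 Q2)
    (x0 : XT C.X P0 P1 ∨ XT C.X P0 P2) (x1 : XT C.X P0 P1 ∨ XT C.X P1 P2)
    (x2 : XT C.X P1 P2 ∨ XT C.X P0 P2)
    (x3 : XT C.X Q0 Q1 ∨ XT C.X Q0 Q2) (x4 : XT C.X Q0 Q1 ∨ XT C.X Q1 Q2)
    (x5 : XT C.X Q1 Q2 ∨ XT C.X Q0 Q2) :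
    HasObs C := by
  let S : Fin 6 → Set C.V := ![P0, P1, P2, Q0, Q1, Q2]
  let Y : Set (Sym2 (Fin 6)) := {e | ∃ a b, a ≠ b ∧ e = s(a, b) ∧ XT C.X (S a) (S b)}
  have hY : ∀ a b, a ≠ b → (s(a, b) ∈ Y ↔ XT C.X (S a) (S b)) := by
    intro a b hab
    constructor
    · rintro ⟨a', b', _, h, hx⟩
      rw [Sym2.eq_iff] at h
      rcases h with ⟨rfl, rfl⟩ | ⟨rfl, rfl⟩
      · exact hx
      · exact hx.symm
    · intro h
      exact ⟨a, b, hab, rfl, h⟩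
  have hno : ∀ S T : Set C.V, S ⊆ A → T ⊆ Aᶜ → ¬ XT C.X S T := by
    rintro S T hS hT ⟨a, ha, b, hb, h⟩
    exact hT hb ((hsep a b h).1 (hS ha))
  have sP : ∀ i : Fin 6, i.1 < 3 → S i ⊆ A := by
    intro i hi x hx
    match i, hi, hx with
    | 0, _, hx => exact (hA x).2 (Or.inl hx)
    | 1, _, hx => exact (hA x).2 (Or.inr (Or.inl hx))
    | 2, _, hx => exact (hA x).2 (Or.inr (Or.inr hx))
    | 3, hi, _ => exact absurd hi (by decide)
    | 4, hi, _ => exact absurd hi (by decide)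
    | 5, hi, _ => exact absurd hi (by decide)
  have sQ : ∀ i : Fin 6, ¬ i.1 < 3 → S i ⊆ Aᶜ := by
    intro i hi x hx
    match i, hi, hx with
    | 3, _, hx => exact (hA' x).2 (Or.inl hx)
    | 4, _, hx => exact (hA' x).2 (Or.inr (Or.inl hx))
    | 5, _, hx => exact (hA' x).2 (Or.inr (Or.inr hx))
    | 0, hi, _ => exact absurd (by decide) hi
    | 1, hi, _ => exact absurd (by decide) hi
    | 2, hi, _ => exact absurd (by decide) hi
  have hSi : ∀ (i : Fin 6) x, x ∈ S i → (i = 0 ∧ x ∈ P0) ∨ (i = 1 ∧ x ∈ P1) ∨ (i = 2 ∧ x ∈ P2) ∨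
      (i = 3 ∧ x ∈ Q0) ∨ (i = 4 ∧ x ∈ Q1) ∨ (i = 5 ∧ x ∈ Q2) := by
    intro i x hx
    match i, hx with
    | 0, hx => exact Or.inl ⟨rfl, hx⟩
    | 1, hx => exact Or.inr (Or.inl ⟨rfl, hx⟩)
    | 2, hx => exact Or.inr (Or.inr (Or.inl ⟨rfl, hx⟩))
    | 3, hx => exact Or.inr (Or.inr (Or.inr (Or.inl ⟨rfl, hx⟩)))
    | 4, hx => exact Or.inr (Or.inr (Or.inr (Or.inr (Or.inl ⟨rfl, hx⟩))))
    | 5, hx => exact Or.inr (Or.inr (Or.inr (Or.inr (Or.inr ⟨rfl, hx⟩))))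
  have hYsub : Y ⊆ topEdges ∪ botEdges := by
    rintro e ⟨a, b, hab, rfl, hx⟩
    have key : a.1 < 3 ↔ b.1 < 3 := by
      constructor
      · intro h; by_contra h'; exact hno _ _ (sP a h) (sQ b h') hx
      · intro h; by_contra h'; exact hno _ _ (sP b h) (sQ a h') hx.symm
    clear hx
    unfold topEdges botEdges
    revert a b
    simp only [Set.mem_union, Set.mem_insert_iff, Set.mem_singleton_iff]
    decide
  have hYtop : ∀ a b, a ≠ b → s(a, b) ∈ topEdges → XT C.X (S a) (S b) → s(a, b) ∈ Y ∩ topEdges :=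
    fun a b h h1 h2 => ⟨(hY a b h).2 h2, h1⟩
  have hYbot : ∀ a b, a ≠ b → s(a, b) ∈ botEdges → XT C.X (S a) (S b) → s(a, b) ∈ Y ∩ botEdges :=
    fun a b h h1 h2 => ⟨(hY a b h).2 h2, h1⟩
  have r1 := tri_cover (a := (0 : Fin 6)) (b := 1) (c := 2) (by decide) (by decide) (by decide)
    (Y ∩ topEdges)
    (x0.imp (hYtop 0 1 (by decide) (by simp [topEdges])) (hYtop 0 2 (by decide) (by simp [topEdges])))
    (x1.imp (hYtop 0 1 (by decide) (by simp [topEdges])) (hYtop 1 2 (by decide) (by simp [topEdges])))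
    (x2.imp (hYtop 1 2 (by decide) (by simp [topEdges])) (hYtop 0 2 (by decide) (by simp [topEdges])))
    (by rintro e ⟨_, (rfl | rfl | rfl)⟩ <;> simp)
  have r2 := tri_cover (a := (3 : Fin 6)) (b := 4) (c := 5) (by decide) (by decide) (by decide)
    (Y ∩ botEdges)
    (x3.imp (hYbot 3 4 (by decide) (by simp [botEdges])) (hYbot 3 5 (by decide) (by simp [botEdges])))
    (x4.imp (hYbot 3 4 (by decide) (by simp [botEdges])) (hYbot 4 5 (by decide) (by simp [botEdges])))
    (x5.imp (hYbot 4 5 (by decide) (by simp [botEdges])) (hYbot 3 5 (by decide) (by simp [botEdges])))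
    (by rintro e ⟨_, (rfl | rfl | rfl)⟩ <;> simp)
  obtain ⟨D, h1, h2⟩ := minor_of_parts C hC S (by
      intro x
      by_cases h : x ∈ A
      · rcases (hA x).1 h with h | h | h
        · exact ⟨0, h⟩
        · exact ⟨1, h⟩
        · exact ⟨2, h⟩
      · rcases (hA' x).1 h with h | h | h
        · exact ⟨3, h⟩
        · exact ⟨4, h⟩
        · exact ⟨5, h⟩) (by
      intro i j x hi hj
      have e0 := d0 x
      have e1 := d1 x
      have e2 := d2 x
      have e3 := d3 x
      have e4 := hA x
      have e5 := hA' x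
      have e6 := hSi i x hi
      have e7 := hSi j x hj
      clear * - e0 e1 e2 e3 e4 e5 e6 e7
      grind) (by
      intro i
      fin_cases i <;> assumption) prismGraph Y (by
      intro i j hij
      have hij' : i ≠ j := hij.ne
      unfold prismGraph at hij
      rw [fromEdgeSet_adj] at hij
      fin_cases i <;> fin_cases j <;> first
        | exact absurd rfl hij'
        | assumption
        | (apply Tch.symm; assumption)
        | (simp at hij)) hY (by
      intro e he
      unfold prismGraph
      rcases hYsub he with (rfl | rfl | rfl) | (rfl | rfl | rfl) <;> simp)
  exact ⟨D, h1, Or.inr (Or.inr ⟨Y, ⟨hYsub, r1.1, r1.2, r2.1, r2.2⟩, h2⟩)⟩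

end Obstructions

section PrismPartition

/-- A partition of the vertex set of `C` inducing a prism. -/
structure PP (C : CGraph) (A : Set C.V) (P Q : Fin 3 → Set C.V) : Prop where
  hA : ∀ x, x ∈ A ↔ ∃ i, x ∈ P i
  hA' : ∀ x, x ∉ A ↔ ∃ i, x ∈ Q i
  dP : ∀ i j x, x ∈ P i → x ∈ P j → i = j
  dQ : ∀ i j x, x ∈ Q i → x ∈ Q j → i = j
  cP : ∀ i, Cn C.G (P i)
  cQ : ∀ i, Cn C.G (Q i)
  tP : ∀ i j, i ≠ j → Tch C.G (P i) (P j)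
  tQ : ∀ i j, i ≠ j → Tch C.G (Q i) (Q j)
  tPQ : ∀ i, Tch C.G (P i) (Q i)
  hsep : ∀ x y, s(x, y) ∈ C.X → (x ∈ A ↔ y ∈ A)
  xP : ∃ i j, i ≠ j ∧ XT C.X (P i) (P j)
  xQ : ∃ i j, i ≠ j ∧ XT C.X (Q i) (Q j)

theorem PP.swap {C : CGraph} {A : Set C.V} {P Q : Fin 3 → Set C.V} (h : PP C A P Q) :
    PP C Aᶜ Q P where
  hA := h.hA'
  hA' := fun x => by rw [Set.mem_compl_iff, not_not]; exact h.hA x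
  dP := h.dQ
  dQ := h.dP
  cP := h.cQ
  cQ := h.cP
  tP := h.tQ
  tQ := h.tP
  tPQ := fun i => (h.tPQ i).symm
  hsep := fun x y hxy => not_congr (h.hsep x y hxy)
  xP := h.xQ
  xQ := h.xP

theorem PP.noPQ {C : CGraph} {A : Set C.V} {P Q : Fin 3 → Set C.V} (h : PP C A P Q) (i j : Fin 3) :
    ¬ XT C.X (P i) (Q j) := by
  rintro ⟨a, ha, b, hb, hab⟩
  exact (h.hA' b).2 ⟨j, hb⟩ ((h.hsep a b hab).1 ((h.hA a).2 ⟨i, ha⟩))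

theorem PP.disj {C : CGraph} {A : Set C.V} {P Q : Fin 3 → Set C.V} (h : PP C A P Q) (i j : Fin 3)
    (x : C.V) (h1 : x ∈ P i) (h2 : x ∈ Q j) : False :=
  (h.hA' x).2 ⟨j, h2⟩ ((h.hA x).2 ⟨i, h1⟩)

theorem PP.cov {C : CGraph} {A : Set C.V} {P Q : Fin 3 → Set C.V} (h : PP C A P Q) (x : C.V) :
    (∃ i, x ∈ P i) ∨ ∃ i, x ∈ Q i := by
  by_cases hx : x ∈ A
  · exact Or.inl ((h.hA x).1 hx)
  · exact Or.inr ((h.hA' x).1 hx)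

theorem PP.obs_iso {C : CGraph} (hC : C.WF) {A : Set C.V} {P Q : Fin 3 → Set C.V}
    (h : PP C A P Q) (i : Fin 3) (hi : ∀ j, j ≠ i → ¬ XT C.X (P i) (P j)) : HasObs C := by
  obtain ⟨j, k, hj, hk, hjk, hall⟩ : ∃ j k : Fin 3, j ≠ i ∧ k ≠ i ∧ j ≠ k ∧
      ∀ l, l = i ∨ l = j ∨ l = k := by
    clear * -
    revert i; decide
  have hxjk : XT C.X (P j) (P k) := by
    obtain ⟨a, b, hab, hx⟩ := h.xP
    have ha : a ≠ i := by
      rintro rfl; exact hi b hab.symm hx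
    have hb : b ≠ i := by
      rintro rfl; exact hi a hab hx.symm
    rcases hall a with rfl | rfl | rfl
    · exact absurd rfl ha
    · rcases hall b with rfl | rfl | rfl
      · exact absurd rfl hb
      · exact absurd rfl hab
      · exact hx
    · rcases hall b with rfl | rfl | rfl
      · exact absurd rfl hb
      · exact hx.symm
      · exact absurd rfl hab
  have cPQ : Cn C.G (P i ∪ Q i) := (h.cP i).union (h.cQ i) (h.tPQ i)
  have covP : ∀ x, (∃ l, x ∈ P l) ↔ x ∈ P i ∨ x ∈ P j ∨ x ∈ P k := by
    intro x
    constructor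
    · rintro ⟨l, hl⟩
      rcases hall l with rfl | rfl | rfl <;> tauto
    · rintro (h | h | h) <;> exact ⟨_, h⟩
  have covQ : ∀ x, (∃ l, x ∈ Q l) ↔ x ∈ Q i ∨ x ∈ Q j ∨ x ∈ Q k := by
    intro x
    constructor
    · rintro ⟨l, hl⟩
      rcases hall l with rfl | rfl | rfl <;> tauto
    · rintro (h | h | h) <;> exact ⟨_, h⟩
  have cov : ∀ x, (x ∈ P i ∨ x ∈ P j ∨ x ∈ P k) ∨ (x ∈ Q i ∨ x ∈ Q j ∨ x ∈ Q k) := by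
    intro x
    rw [← covP, ← covQ]; exact h.cov x
  by_cases hQ : XT C.X (Q i) (Q j) ∨ XT C.X (Q i) (Q k)
  · refine obs_K4 C hC (P j ∪ P k) (P j) (P k) (P i ∪ Q i) (Q j ∪ Q k) (fun x => Iff.rfl) ?_ ?_ ?_
      (h.cP j) (h.cP k) cPQ ((h.cQ j).union (h.cQ k) (h.tQ j k hjk)) ?_ hxjk ?_ ?_ ?_ ?_ ?_
    · intro x
      have h1 := cov x
      have h2 := h.disj j
      have h3 := h.disj k
      have h4 := h.dP i j x
      have h5 := h.dP i k x
      simp only [Set.mem_union]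
      constructor
      · tauto
      · rintro ((hx | hx) | (hx | hx)) (hy | hy)
        · exact hj (h4 hx hy).symm
        · exact hk (h5 hx hy).symm
        · exact h2 _ _ hy hx
        · exact h3 _ _ hy hx
        · exact h2 _ _ hy hx
        · exact h3 _ _ hy hx
        · exact h2 _ _ hy hx
        · exact h3 _ _ hy hx
    · intro x h1 h2
      exact hjk (h.dP _ _ x h1 h2)
    · rintro x (h1 | h1) (h2 | h2)
      · exact h.disj _ _ x h1 h2
      · exact h.disj _ _ x h1 h2
      · exact hj (h.dQ _ _ x h2 h1)
      · exact hk (h.dQ _ _ x h2 h1)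
    · have key : ∀ x y, s(x, y) ∈ C.X → x ∈ P j ∪ P k → y ∈ P j ∪ P k := by
        intro x y hxy hx
        have hxA : x ∈ A := (h.hA x).2 ((covP x).2 (by rcases hx with hx | hx <;> tauto))
        have hyA := (h.hsep x y hxy).1 hxA
        rcases (covP y).1 ((h.hA y).1 hyA) with hy | hy
        · exfalso
          rcases hx with hx | hx
          · exact hi j hj ⟨y, hy, x, hx, by rwa [Sym2.eq_swap]⟩
          · exact hi k hk ⟨y, hy, x, hx, by rwa [Sym2.eq_swap]⟩
        · exact hy
      intro x y hxy
      exact ⟨key x y hxy, key y x (by rwa [Sym2.eq_swap])⟩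
    · rcases hQ with hQ | hQ
      · exact hQ.mono Set.subset_union_right Set.subset_union_left
      · exact hQ.mono Set.subset_union_right Set.subset_union_right
    · exact (h.tP j i hj).mono subset_rfl Set.subset_union_left
    · exact (h.tPQ j).mono subset_rfl Set.subset_union_left
    · exact (h.tP k i hk).mono subset_rfl Set.subset_union_left
    · exact (h.tPQ k).mono subset_rfl Set.subset_union_right
  · push Not at hQ
    have hxQ : XT C.X (Q k) (Q j) := by
      obtain ⟨a, b, hab, hx⟩ := h.xQ
      rcases hall a with rfl | rfl | rfl
      · rcases hall b with rfl | rfl | rfl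
        · exact absurd rfl hab
        · exact absurd hx hQ.1
        · exact absurd hx hQ.2
      · rcases hall b with rfl | rfl | rfl
        · exact absurd hx.symm hQ.1
        · exact absurd rfl hab
        · exact hx.symm
      · rcases hall b with rfl | rfl | rfl
        · exact absurd hx.symm hQ.2
        · exact hx
        · exact absurd rfl hab
    have nPH : ∀ l, l ≠ i → ¬ XT C.X (P l) (P i ∪ Q i) := by
      rintro l hl ⟨a, ha, b, hb | hb, hab⟩
      · exact hi l hl (XT.symm ⟨a, ha, b, hb, hab⟩)
      · exact h.noPQ l i ⟨a, ha, b, hb, hab⟩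
    have nQH : ∀ l, l ≠ i → ¬ XT C.X (Q l) (P i ∪ Q i) := by
      rintro l hl ⟨a, ha, b, hb | hb, hab⟩
      · exact h.noPQ i l (XT.symm ⟨a, ha, b, hb, hab⟩)
      · have : XT C.X (Q i) (Q l) := XT.symm ⟨a, ha, b, hb, hab⟩
        rcases hall l with rfl | rfl | rfl
        · exact hl rfl
        · exact hQ.1 this
        · exact hQ.2 this
    have dPH : ∀ l, l ≠ i → ∀ x ∈ P l, x ∉ P i ∪ Q i := by
      rintro l hl x hx (hy | hy)
      · exact hl (h.dP _ _ x hx hy)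
      · exact h.disj _ _ x hx hy
    have dQH : ∀ l, l ≠ i → ∀ x ∈ Q l, x ∉ P i ∪ Q i := by
      rintro l hl x hx (hy | hy)
      · exact h.disj _ _ x hy hx
      · exact hl (h.dQ _ _ x hx hy)
    refine obs_wheel C hC (P j) (P k) (Q k) (Q j) (P i ∪ Q i) ?_ ?_ ?_ ?_ (dQH j hj)
      (h.cP j) (h.cP k) (h.cQ k) (h.cQ j) cPQ hxjk hxQ (h.noPQ _ _) (h.noPQ _ _) (h.noPQ _ _)
      (h.noPQ _ _) (nPH j hj) (nPH k hk) (nQH k hk) (nQH j hj) (h.tPQ k) (h.tPQ j)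
      ((h.tP j i hj).mono subset_rfl Set.subset_union_left)
      ((h.tP k i hk).mono subset_rfl Set.subset_union_left)
      ((h.tQ k i hk).mono subset_rfl Set.subset_union_right)
      ((h.tQ j i hj).mono subset_rfl Set.subset_union_right)
    · intro x
      have := cov x
      simp only [Set.mem_union]
      tauto
    · exact fun x hx => ⟨fun h' => hjk (h.dP _ _ x hx h'), fun h' => h.disj _ _ x hx h',
        fun h' => h.disj _ _ x hx h', dPH j hj x hx⟩
    · exact fun x hx => ⟨fun h' => h.disj _ _ x hx h',
        fun h' => h.disj _ _ x hx h', dPH k hk x hx⟩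
    · exact fun x hx => ⟨fun h' => hjk (h.dQ _ _ x h' hx), dQH k hk x hx⟩

theorem PP.obs {C : CGraph} (hC : C.WF) {A : Set C.V} {P Q : Fin 3 → Set C.V}
    (h : PP C A P Q) : HasObs C := by
  by_cases h1 : ∃ i, ∀ j, j ≠ i → ¬ XT C.X (P i) (P j)
  · obtain ⟨i, hi⟩ := h1
    exact h.obs_iso hC i hi
  by_cases h2 : ∃ i, ∀ j, j ≠ i → ¬ XT C.X (Q i) (Q j)
  · obtain ⟨i, hi⟩ := h2
    exact h.swap.obs_iso hC i hi
  push Not at h1 h2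
  have key : ∀ R : Fin 3 → Set C.V, (∀ i, ∃ j, j ≠ i ∧ XT C.X (R i) (R j)) →
      (XT C.X (R 0) (R 1) ∨ XT C.X (R 0) (R 2)) ∧ (XT C.X (R 0) (R 1) ∨ XT C.X (R 1) (R 2)) ∧
      (XT C.X (R 1) (R 2) ∨ XT C.X (R 0) (R 2)) := by
    intro R hR
    refine ⟨?_, ?_, ?_⟩
    · obtain ⟨j, hj, hx⟩ := hR 0
      match j, hj, hx with
      | 0, hj, _ => exact absurd rfl hj
      | 1, _, hx => exact Or.inl hx
      | 2, _, hx => exact Or.inr hx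
    · obtain ⟨j, hj, hx⟩ := hR 1
      match j, hj, hx with
      | 1, hj, _ => exact absurd rfl hj
      | 0, _, hx => exact Or.inl hx.symm
      | 2, _, hx => exact Or.inr hx
    · obtain ⟨j, hj, hx⟩ := hR 2
      match j, hj, hx with
      | 2, hj, _ => exact absurd rfl hj
      | 1, _, hx => exact Or.inl hx.symm
      | 0, _, hx => exact Or.inr hx.symm
  obtain ⟨p0, p1, p2⟩ := key P h1
  obtain ⟨q0, q1, q2⟩ := key Q h2
  have hex : ∀ R : Fin 3 → Set C.V, ∀ x, (∃ i, x ∈ R i) ↔ (x ∈ R 0 ∨ x ∈ R 1 ∨ x ∈ R 2) := by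
    intro R x
    rw [Fin.exists_fin_succ, Fin.exists_fin_succ, Fin.exists_fin_succ]
    simp
  exact obs_prism C hC A (P 0) (P 1) (P 2) (Q 0) (Q 1) (Q 2)
    (fun x => (h.hA x).trans (hex P x)) (fun x => (h.hA' x).trans (hex Q x))
    (fun x hx => ⟨fun h' => absurd (h.dP _ _ x hx h') (by decide),
      fun h' => absurd (h.dP _ _ x hx h') (by decide)⟩)
    (fun x hx h' => absurd (h.dP _ _ x hx h') (by decide))
    (fun x hx => ⟨fun h' => absurd (h.dQ _ _ x hx h') (by decide),
      fun h' => absurd (h.dQ _ _ x hx h') (by decide)⟩)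
    (fun x hx h' => absurd (h.dQ _ _ x hx h') (by decide))
    (h.cP 0) (h.cP 1) (h.cP 2) (h.cQ 0) (h.cQ 1) (h.cQ 2) h.hsep
    (h.tP _ _ (by decide)) (h.tP _ _ (by decide)) (h.tP _ _ (by decide))
    (h.tQ _ _ (by decide)) (h.tQ _ _ (by decide)) (h.tQ _ _ (by decide))
    (h.tPQ 0) (h.tPQ 1) (h.tPQ 2) p0 p1 p2 q0 q1 q2

end PrismPartition

section Forward

/-- Cut form of disconnectedness of an edge set. -/
theorem edgeSet_conn_cut {V : Type*} {X : Set (Sym2 V)} (h : EdgeSetConnected X) (T : Set V)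
    (hT : ∀ x y, s(x, y) ∈ X → x ≠ y → x ∈ T → y ∈ T) {a b c d : V} (hab : s(a, b) ∈ X)
    (hne : a ≠ b) (hcd : s(c, d) ∈ X) (hne' : c ≠ d) (ha : a ∈ T) : c ∈ T := by
  have h1 : (fromEdgeSet X).Adj a b := by rw [fromEdgeSet_adj]; exact ⟨hab, hne⟩
  have h2 : (fromEdgeSet X).Adj c d := by rw [fromEdgeSet_adj]; exact ⟨hcd, hne'⟩
  obtain ⟨w⟩ := h a ⟨b, h1⟩ c ⟨d, h2⟩
  clear h1 h2 hab hcd hne hne'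
  induction w with
  | nil => exact ha
  | cons hadj _ ih =>
    rw [fromEdgeSet_adj] at hadj
    exact ih (hT _ _ hadj.1 hadj.2 ha)

theorem edgeSet_conn_map {V W : Type*} {X : Set (Sym2 V)} (f : V → W) (h : EdgeSetConnected X) :
    EdgeSetConnected {e | e ∈ Sym2.map f '' X ∧ ¬ e.IsDiag} := by
  have hr : ∀ x y, (fromEdgeSet X).Reachable x y →
      (fromEdgeSet {e | e ∈ Sym2.map f '' X ∧ ¬ e.IsDiag}).Reachable (f x) (f y) := by
    rintro x y ⟨w⟩
    induction w with
    | nil => exact Reachable.refl _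
    | @cons a b c hadj _ ih =>
      rw [fromEdgeSet_adj] at hadj
      by_cases hab : f a = f b
      · rw [hab]; exact ih
      · refine Reachable.trans (Adj.reachable ?_) ih
        rw [fromEdgeSet_adj]
        exact ⟨⟨⟨s(a, b), hadj.1, rfl⟩, by simpa using hab⟩, hab⟩
  have hsup : ∀ u ∈ (fromEdgeSet {e | e ∈ Sym2.map f '' X ∧ ¬ e.IsDiag}).support,
      ∃ x ∈ (fromEdgeSet X).support, f x = u := by
    intro u hu
    obtain ⟨v, hv⟩ := (mem_support _).1 hu
    rw [fromEdgeSet_adj] at hv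
    obtain ⟨⟨h1, _⟩, hne⟩ := hv
    obtain ⟨x, y, hxy, rfl, rfl⟩ := (mem_map_image_iff f X u v).1 h1
    refine ⟨x, (mem_support _).2 ⟨y, ?_⟩, rfl⟩
    rw [fromEdgeSet_adj]
    exact ⟨hxy, fun h => hne (by rw [h])⟩
  intro u hu v hv
  obtain ⟨x, hx, rfl⟩ := hsup u hu
  obtain ⟨y, hy, rfl⟩ := hsup v hv
  exact hr x y (h x hx y hy)

theorem conn_minor {C D : CGraph} (h : IsCMinor C D) (hC : EdgeSetConnected C.X) :
    EdgeSetConnected D.X := by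
  unfold IsCMinor at h
  induction h with
  | refl => exact hC
  | tail _ hstep ih =>
    cases hstep with
    | del e he hx => exact ih
    | contr u v h => exact edgeSet_conn_map _ ih

theorem conn_iso_cut {D : CGraph} {W : Type} {fin : Finite W} {GW : SimpleGraph W}
    {Y : Set (Sym2 W)} (hiso : CGIso D ⟨W, GW, Y, fin⟩) (hD : EdgeSetConnected D.X) (T : W → Prop)
    (hT : ∀ x y, s(x, y) ∈ Y → T x → T y) {a b c d : W} (hab : s(a, b) ∈ Y)
    (hne : a ≠ b) (hcd : s(c, d) ∈ Y) (hne' : c ≠ d) (ha : T a) : T c := by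
  obtain ⟨φ, hφ⟩ := hiso
  change Sym2.map φ '' D.X = Y at hφ
  rw [← hφ] at hT hab hcd
  obtain ⟨a', b', hab', rfl, rfl⟩ := (mem_map_image_iff φ D.X a b).1 hab
  obtain ⟨c', d', hcd', rfl, rfl⟩ := (mem_map_image_iff φ D.X c d).1 hcd
  refine edgeSet_conn_cut hD {x | T (φ x)} ?_ hab' (fun h => hne (by rw [h])) hcd'
    (fun h => hne' (by rw [h])) ha
  intro x y hxy _ hx
  exact hT (φ x) (φ y) ⟨s(x, y), hxy, rfl⟩ hx

theorem obs_not_conn {D : CGraph} (hobs : IsObstruction D) : ¬ EdgeSetConnected D.X := by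
  intro hD
  rcases hobs with h | h | ⟨X, hX, h⟩
  · have key : ∀ x y : Fin 4, s(x, y) = s(0, 1) ∨ s(x, y) = s(2, 3) → x = 0 ∨ x = 1 → y = 0 ∨ y = 1 := by
      decide
    have := conn_iso_cut h hD (fun x : Fin 4 => x = 0 ∨ x = 1) key
      (a := (0 : Fin 4)) (b := (1 : Fin 4)) (c := (2 : Fin 4)) (d := (3 : Fin 4))
      (Or.inl rfl) (by decide) (Or.inr rfl) (by decide) (Or.inl rfl)
    exact absurd this (by decide)
  · have key : ∀ x y : Fin 5, s(x, y) = s(0, 1) ∨ s(x, y) = s(2, 3) → x = 0 ∨ x = 1 → y = 0 ∨ y = 1 := by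
      decide
    have := conn_iso_cut h hD (fun x : Fin 5 => x = 0 ∨ x = 1) key
      (a := (0 : Fin 5)) (b := (1 : Fin 5)) (c := (2 : Fin 5)) (d := (3 : Fin 5))
      (Or.inl rfl) (by decide) (Or.inr rfl) (by decide) (Or.inl rfl)
    exact absurd this (by decide)
  · obtain ⟨hsub, _, h1, _, h2⟩ := hX
    have e1 : (0 : Fin 6) ∈ (fromEdgeSet (X ∩ topEdges)).support := by rw [h1]; simp
    have e2 : (3 : Fin 6) ∈ (fromEdgeSet (X ∩ botEdges)).support := by rw [h2]; simp
    obtain ⟨b, hb⟩ := (mem_support _).1 e1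
    obtain ⟨d, hd⟩ := (mem_support _).1 e2
    rw [fromEdgeSet_adj] at hb hd
    have key : ∀ x y : Fin 6, (s(x, y) = s(0, 1) ∨ s(x, y) = s(1, 2) ∨ s(x, y) = s(0, 2)) ∨
        (s(x, y) = s(3, 4) ∨ s(x, y) = s(4, 5) ∨ s(x, y) = s(3, 5)) →
        x = 0 ∨ x = 1 ∨ x = 2 → y = 0 ∨ y = 1 ∨ y = 2 := by
      decide
    have := conn_iso_cut h hD (fun x : Fin 6 => x = 0 ∨ x = 1 ∨ x = 2)
      (fun x y hxy => key x y (hsub hxy))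
      (a := (0 : Fin 6)) (b := b) (c := (3 : Fin 6)) (d := d)
      hb.1.1 hb.2 hd.1.1 hd.2 (Or.inl rfl)
    exact absurd this (by decide)

end Forward

section Outcome

variable {V : Type*} {G : SimpleGraph V}

/-- Outcome: `B` splits into two connected parts each meeting `N₁` and `N₂`. -/
def OutA (G : SimpleGraph V) (B : Set V) (b₁ b₂ : V) (N₁ N₂ : Set V) : Prop :=
  ∃ S T : Set V, (∀ x, x ∈ B ↔ (x ∈ S ∨ x ∈ T)) ∧ (∀ x ∈ S, x ∉ T) ∧ Cn G S ∧ Cn G T ∧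
    b₁ ∈ S ∧ b₂ ∈ T ∧ (∃ n ∈ S, n ∈ N₁) ∧ (∃ n ∈ S, n ∈ N₂) ∧ (∃ n ∈ T, n ∈ N₁) ∧
    (∃ n ∈ T, n ∈ N₂)

/-- Outcome: `B` splits into three connected parts forming a path with middle part `H`. -/
def OutB (G : SimpleGraph V) (B : Set V) (b₁ b₂ : V) (N₁ N₂ : Set V) : Prop :=
  ∃ P H Q : Set V, (∀ x, x ∈ B ↔ (x ∈ P ∨ x ∈ H ∨ x ∈ Q)) ∧ (∀ x ∈ P, x ∉ H ∧ x ∉ Q) ∧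
    (∀ x ∈ H, x ∉ Q) ∧ Cn G P ∧ Cn G H ∧ Cn G Q ∧ b₁ ∈ P ∧ b₂ ∈ Q ∧ Tch G P H ∧ Tch G Q H ∧
    (∃ n ∈ H, n ∈ N₁) ∧ (∃ n ∈ H, n ∈ N₂) ∧
    (((∃ n ∈ P, n ∈ N₁) ∧ ∃ n ∈ Q, n ∈ N₂) ∨ ((∃ n ∈ P, n ∈ N₂) ∧ ∃ n ∈ Q, n ∈ N₁))

theorem OutA.symm {B : Set V} {b₁ b₂ : V} {N₁ N₂ : Set V} (h : OutA G B b₁ b₂ N₁ N₂) :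
    OutA G B b₁ b₂ N₂ N₁ := by
  obtain ⟨S, T, a, b, c, d, e, f, x, y, z, w⟩ := h
  exact ⟨S, T, a, b, c, d, e, f, y, x, w, z⟩

theorem OutB.symm {B : Set V} {b₁ b₂ : V} {N₁ N₂ : Set V} (h : OutB G B b₁ b₂ N₁ N₂) :
    OutB G B b₁ b₂ N₂ N₁ := by
  obtain ⟨P, H, Q, a, b, c, d, e, f, h1, h2, h3, h4, x, y, z⟩ := h
  exact ⟨P, H, Q, a, b, c, d, e, f, h1, h2, h3, h4, y, x, z.symm⟩

variable [Finite V]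

theorem STLab.split {B : Set V} {b₁ b₂ : V} {g : V → ℤ} (h : STLab G B b₁ b₂ g)
    (hb₁ : b₁ ∈ B) (hb₂ : b₂ ∈ B) {N₁ N₂ : Set V} {p q r s : V} (hp : p ∈ B) (hq : q ∈ B)
    (hr : r ∈ B) (hs : s ∈ B) (pN : p ∈ N₁) (qN : q ∈ N₁) (rN : r ∈ N₂) (sN : s ∈ N₂) (t : ℤ)
    (h1 : g p ≤ t) (h2 : g r ≤ t) (h3 : t < g q) (h4 : t < g s) : OutA G B b₁ b₂ N₁ N₂ := by
  have m1 := h.min_le hp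
  have m2 := h.le_max hq
  refine ⟨{v | v ∈ B ∧ g v ≤ t}, {v | v ∈ B ∧ t + 1 ≤ g v}, ?_, ?_, h.initSeg hb₁ (by omega),
    h.tailSeg hb₂ (by omega), ⟨hb₁, by omega⟩, ⟨hb₂, by omega⟩, ⟨p, ⟨hp, h1⟩, pN⟩, ⟨r, ⟨hr, h2⟩, rN⟩,
    ⟨q, ⟨hq, by omega⟩, qN⟩, ⟨s, ⟨hs, by omega⟩, sN⟩⟩
  · intro x
    constructor
    · intro hx
      rcases le_or_gt (g x) t with h | h
      · exact Or.inl ⟨hx, h⟩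
      · exact Or.inr ⟨hx, by omega⟩
    · rintro (h | h) <;> exact h.1
  · rintro x ⟨_, h5⟩ ⟨_, h6⟩
    omega

theorem STLab.mergeLab {B : Set V} {b₁ b₂ : V} {g : V → ℤ} (h : STLab G B b₁ b₂ g) {t : ℤ}
    (h1 : g b₁ < t) (h2 : t + 1 < g b₂) {x y : V} (hx : x ∈ B) (hy : y ∈ B) (hxt : g x = t)
    (hyt : g y = t + 1) (hxy : G.Adj x y) :
    STLab G B b₁ b₂ (fun v => if g v = t then t + 1 else g v) := by
  set gn : V → ℤ := fun v => if g v = t then t + 1 else g v with hg'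
  have hc : ∀ v, (g v = t ∧ gn v = t + 1) ∨ (g v ≠ t ∧ gn v = g v) := by
    intro v
    by_cases hv : g v = t
    · exact Or.inl ⟨hv, by simp [hg', hv]⟩
    · exact Or.inr ⟨hv, by simp [hg', hv]⟩
  have c1 := hc b₁
  have c2 := hc b₂
  refine ⟨?_, ?_, ?_⟩
  · intro w hw
    by_cases hwt : gn w = t + 1
    · have : {v | v ∈ B ∧ gn v = gn w} = {v | v ∈ B ∧ g v = g x} ∪ {v | v ∈ B ∧ g v = g y} := by
        ext v
        simp only [Set.mem_union, Set.mem_setOf_eq]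
        have := hc v
        constructor
        · rintro ⟨h5, h6⟩
          by_cases h7 : g v = t
          · exact Or.inl ⟨h5, by omega⟩
          · exact Or.inr ⟨h5, by omega⟩
        · rintro (⟨h5, h6⟩ | ⟨h5, h6⟩) <;> exact ⟨h5, by omega⟩
      rw [this]
      exact (h.fib x hx).union (h.fib y hy) ⟨x, ⟨hx, rfl⟩, y, ⟨hy, rfl⟩, hxy⟩
    · have : {v | v ∈ B ∧ gn v = gn w} = {v | v ∈ B ∧ g v = g w} := by
        ext v
        have e1 := hc v
        have e2 := hc w
        simp only [Set.mem_setOf_eq]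
        refine and_congr_right fun _ => ?_
        omega
      rw [this]; exact h.fib w hw
  · intro w hw hne
    have e2 := hc w
    by_cases hwt : gn w = t + 1
    · obtain ⟨v, hv, v', hv', a, b, c⟩ := h.low x hx (by omega)
      have e3 := hc v
      have e4 := hc v'
      exact ⟨v, hv, v', hv', a, by omega, by omega⟩
    · obtain ⟨v, hv, v', hv', a, b, c⟩ := h.low w hw (by omega)
      have e3 := hc v
      have e4 := hc v'
      exact ⟨v, hv, v', hv', a, by omega, by omega⟩
  · intro w hw hne
    have e2 := hc w
    by_cases hwt : gn w = t + 1
    · obtain ⟨v, hv, v', hv', a, b, c⟩ := h.high y hy (by omega)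
      have e3 := hc v
      have e4 := hc v'
      exact ⟨v, hv, v', hv', a, by omega, by omega⟩
    · obtain ⟨v, hv, v', hv', a, b, c⟩ := h.high w hw (by omega)
      have e3 := hc v
      have e4 := hc v'
      exact ⟨v, hv, v', hv', a, by omega, by omega⟩

theorem STLab.swapLab {B : Set V} {b₁ b₂ : V} {g : V → ℤ} (h : STLab G B b₁ b₂ g) {t : ℤ}
    (h1 : g b₁ < t) (h2 : t + 1 < g b₂)
    (hno : ∀ x ∈ B, ∀ y ∈ B, g x = t → g y = t + 1 → ¬ G.Adj x y) :
    STLab G B b₁ b₂ (fun v => if g v = t then t + 1 else if g v = t + 1 then t else g v) := by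
  set gn : V → ℤ := fun v => if g v = t then t + 1 else if g v = t + 1 then t else g v with hg'
  have hc : ∀ v, (g v = t ∧ gn v = t + 1) ∨ (g v = t + 1 ∧ gn v = t) ∨
      (g v ≠ t ∧ g v ≠ t + 1 ∧ gn v = g v) := by
    intro v
    by_cases hv : g v = t
    · exact Or.inl ⟨hv, by simp [hg', hv]⟩
    · by_cases hv' : g v = t + 1
      · exact Or.inr (Or.inl ⟨hv', by simp [hg', hv']⟩)
      · exact Or.inr (Or.inr ⟨hv, hv', by simp [hg', hv, hv']⟩)
  have c1 := hc b₁
  have c2 := hc b₂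
  refine ⟨?_, ?_, ?_⟩
  · intro w hw
    have : {v | v ∈ B ∧ gn v = gn w} = {v | v ∈ B ∧ g v = g w} := by
      ext v
      have e1 := hc v
      have e2 := hc w
      simp only [Set.mem_setOf_eq]
      refine and_congr_right fun _ => ?_
      omega
    rw [this]; exact h.fib w hw
  · intro w hw hne
    have e2 := hc w
    obtain ⟨v, hv, v', hv', a, b, c⟩ := h.low w hw (by omega)
    have e3 := hc v
    have e4 := hc v'
    have e5 : ¬ (g v' = t ∧ g v = t + 1) := fun h' => hno v' hv' v hv h'.1 h'.2 a.symm
    exact ⟨v, hv, v', hv', a, by omega, by omega⟩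
  · intro w hw hne
    have e2 := hc w
    obtain ⟨v, hv, v', hv', a, b, c⟩ := h.high w hw (by omega)
    have e3 := hc v
    have e4 := hc v'
    have e5 : ¬ (g v = t ∧ g v' = t + 1) := fun h' => hno v hv v' hv' h'.1 h'.2 a
    exact ⟨v, hv, v', hv', a, by omega, by omega⟩

theorem STLab.gap {B : Set V} {b₁ b₂ : V} (hb₁ : b₁ ∈ B) (hb₂ : b₂ ∈ B) {N₁ N₂ : Set V}
    {p q r s : V} (hp : p ∈ B) (hq : q ∈ B)
    (hr : r ∈ B) (hs : s ∈ B) (pN : p ∈ N₁) (qN : q ∈ N₁) (rN : r ∈ N₂) (sN : s ∈ N₂) (n : ℕ) :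
    ∀ g : V → ℤ, STLab G B b₁ b₂ g → g p < g q → g q ≤ g r → g r < g s → g r - g q = n →
      OutA G B b₁ b₂ N₁ N₂ ∨ OutB G B b₁ b₂ N₁ N₂ := by
  induction n using Nat.strong_induction_on with
  | _ n ih =>
    intro g h h1 h2 h3 hn
    have m1 := h.min_le hp
    have m2 := h.le_max hs
    by_cases h0 : g q = g r
    · right
      refine ⟨{v | v ∈ B ∧ g v ≤ g q - 1}, {v | v ∈ B ∧ g v = g q}, {v | v ∈ B ∧ g q + 1 ≤ g v},
        ?_, ?_, ?_, h.initSeg hb₁ (by omega), h.fib q hq, h.tailSeg hb₂ (by omega),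
        ⟨hb₁, by omega⟩, ⟨hb₂, by omega⟩, ?_, ?_, ⟨q, ⟨hq, rfl⟩, qN⟩, ⟨r, ⟨hr, h0.symm⟩, rN⟩,
        Or.inl ⟨⟨p, ⟨hp, by omega⟩, pN⟩, ⟨s, ⟨hs, by omega⟩, sN⟩⟩⟩
      · intro x
        constructor
        · intro hx
          rcases lt_trichotomy (g x) (g q) with h | h | h
          · exact Or.inl ⟨hx, by omega⟩
          · exact Or.inr (Or.inl ⟨hx, h⟩)
          · exact Or.inr (Or.inr ⟨hx, by omega⟩)
        · rintro (h | h | h) <;> exact h.1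
      · rintro x ⟨_, h5⟩
        exact ⟨fun h6 => by have := h6.2; omega, fun h6 => by have := h6.2; omega⟩
      · rintro x ⟨_, h5⟩ ⟨_, h6⟩
        omega
      · obtain ⟨v, hv, v', hv', a, b, c⟩ := h.low q hq (by omega)
        exact ⟨v', ⟨hv', by omega⟩, v, ⟨hv, b⟩, a.symm⟩
      · obtain ⟨v, hv, v', hv', a, b, c⟩ := h.high q hq (by omega)
        exact ⟨v', ⟨hv', by omega⟩, v, ⟨hv, b⟩, a.symm⟩
    · by_cases hadj : ∃ x ∈ B, ∃ y ∈ B, g x = g q ∧ g y = g q + 1 ∧ G.Adj x y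
      · obtain ⟨x, hx, y, hy, hxt, hyt, hxy⟩ := hadj
        have h' := h.mergeLab (t := g q) (by omega) (by omega) hx hy hxt hyt hxy
        have e1 : ¬ g p = g q := by omega
        have e2 : ¬ g r = g q := by omega
        have e3 : ¬ g s = g q := by omega
        refine ih (n - 1) (by omega) _ h' ?_ ?_ ?_ ?_
        · simp only [e1, if_true, if_false]; omega
        · simp only [e2, if_true, if_false]; omega
        · simp only [e2, e3, if_false]; omega
        · simp only [e2, if_true, if_false]; omega
      · push Not at hadj
        have h' := h.swapLab (t := g q) (by omega) (by omega) hadj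
        have e1 : ¬ g p = g q := by omega
        have e1' : ¬ g p = g q + 1 := by omega
        have e2 : ¬ g r = g q := by omega
        have e3 : ¬ g s = g q := by omega
        have e3' : ¬ g s = g q + 1 := by omega
        by_cases e2' : g r = g q + 1
        · left
          refine h'.split hb₁ hb₂ hp hq hr hs pN qN rN sN (g q) ?_ ?_ ?_ ?_
          · simp only [e1, e1', if_false]; omega
          · simp only [e2, e2', if_true, if_false]; omega
          · simp only [if_true]; omega
          · simp only [e3, e3', if_false]; omega
        · refine ih (n - 1) (by omega) _ h' ?_ ?_ ?_ ?_
          · simp only [e1, e1', if_true, if_false]; omega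
          · simp only [e2, e2', if_true, if_false]; omega
          · simp only [e2, e2', e3, e3', if_false]; omega
          · simp only [e2, e2', if_true, if_false]; omega

theorem exists_outcome {B : Set V} {b₁ b₂ : V} (hB : Cn G B) (hb₁ : b₁ ∈ B) (hb₂ : b₂ ∈ B)
    (hne : b₁ ≠ b₂) {N₁ N₂ : Set V} (g1 : Good G B b₁ b₂ N₁) (g2 : Good G B b₁ b₂ N₂) :
    OutA G B b₁ b₂ N₁ N₂ ∨ OutB G B b₁ b₂ N₁ N₂ := by
  obtain ⟨g, hg, hN⟩ := exists_STLab hB hb₁ hb₂ hne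
  obtain ⟨p, hp, q, hq, pN, qN, hpq⟩ := hN N₁ g1
  obtain ⟨r, hr, s, hs, rN, sN, hrs⟩ := hN N₂ g2
  by_cases h1 : g q ≤ g r
  · exact STLab.gap hb₁ hb₂ hp hq hr hs pN qN rN sN _ g hg hpq h1 hrs
      (Int.toNat_of_nonneg (by omega)).symm
  by_cases h2 : g s ≤ g p
  · exact (STLab.gap hb₁ hb₂ hr hs hp hq rN sN pN qN _ g hg hrs h2 hpq
      (Int.toNat_of_nonneg (by omega)).symm).imp OutA.symm OutB.symm
  left
  refine hg.split hb₁ hb₂ hp hq hr hs pN qN rN sN (max (g p) (g r)) ?_ ?_ ?_ ?_ <;> omega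

end Outcome

section LemmaM

/-- The neighbourhood of `A` . -/
def Nb {V : Type*} (G : SimpleGraph V) (A : Set V) : Set V := {b | ∃ a ∈ A, G.Adj a b}

theorem lemmaM (C : CGraph) (hC : C.WF) (A A1 A2 : Set C.V)
    (hA : ∀ x, x ∈ A ↔ (x ∈ A1 ∨ x ∈ A2)) (d12 : ∀ x ∈ A1, x ∉ A2)
    (c1 : Cn C.G A1) (c2 : Cn C.G A2) (cB : Cn C.G Aᶜ)
    (hsep : ∀ x y, s(x, y) ∈ C.X → (x ∈ A ↔ y ∈ A))
    (x12 : XT C.X A1 A2) {b₁ b₂ : C.V} (hb₁ : b₁ ∉ A) (hb₂ : b₂ ∉ A) (hb : s(b₁, b₂) ∈ C.X)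
    (g1 : Good C.G Aᶜ b₁ b₂ (Nb C.G A1)) (g2 : Good C.G Aᶜ b₁ b₂ (Nb C.G A2)) : HasObs C := by
  have hne : b₁ ≠ b₂ := by
    have : C.G.Adj b₁ b₂ := hC hb
    exact this.ne
  have tch : ∀ A0 S : Set C.V, (∃ n ∈ S, n ∈ Nb C.G A0) → Tch C.G A0 S := by
    rintro A0 S ⟨n, hn, a, ha, hadj⟩
    exact ⟨a, ha, n, hn, hadj⟩
  have s1 : A1 ⊆ A := fun x hx => (hA x).2 (Or.inl hx)
  have s2 : A2 ⊆ A := fun x hx => (hA x).2 (Or.inr hx)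
  have hno : ∀ S T : Set C.V, S ⊆ A → T ⊆ Aᶜ → ¬ XT C.X S T := by
    rintro S T hS hT ⟨a, ha, b, hb, h⟩
    exact hT hb ((hsep a b h).1 (hS ha))
  rcases exists_outcome cB hb₁ hb₂ hne g1 g2 with h | h
  · obtain ⟨S, T, hB, hd, cS, cT, h1, h2, n1, n2, n3, n4⟩ := h
    exact obs_K4 C hC A A1 A2 S T hA hB d12 hd c1 c2 cS cT hsep x12 ⟨b₁, h1, b₂, h2, hb⟩
      (tch _ _ n1) (tch _ _ n3) (tch _ _ n2) (tch _ _ n4)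
  · obtain ⟨P, H, Q, hB, hd, hd', cP, cH, cQ, h1, h2, tPH, tQH, nH1, nH2, hn⟩ := h
    have xPQ : XT C.X P Q := ⟨b₁, h1, b₂, h2, hb⟩
    have tPQ : Tch C.G P Q := ⟨b₁, h1, b₂, h2, hC hb⟩
    have sP : P ⊆ Aᶜ := fun x hx => (hB x).2 (Or.inl hx)
    have sH : H ⊆ Aᶜ := fun x hx => (hB x).2 (Or.inr (Or.inl hx))
    have sQ : Q ⊆ Aᶜ := fun x hx => (hB x).2 (Or.inr (Or.inr hx))
    by_cases hx : XT C.X (P ∪ Q) H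
    · refine obs_K4 C hC A A1 A2 (P ∪ Q) H hA ?_ d12 ?_ c1 c2 (cP.union cQ tPQ) cH hsep x12 hx
        ?_ (tch _ _ nH1) ?_ (tch _ _ nH2)
      · intro x
        have := hB x
        simp only [Set.mem_union, Set.mem_compl_iff] at this ⊢
        tauto
      · rintro x (hx | hx) hxH
        · exact (hd x hx).1 hxH
        · exact hd' x hxH hx
      · rcases hn with ⟨n1, n2⟩ | ⟨n1, n2⟩
        · exact (tch _ _ n1).mono subset_rfl Set.subset_union_left
        · exact (tch _ _ n2).mono subset_rfl Set.subset_union_right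
      · rcases hn with ⟨n1, n2⟩ | ⟨n1, n2⟩
        · exact (tch _ _ n2).mono subset_rfl Set.subset_union_right
        · exact (tch _ _ n1).mono subset_rfl Set.subset_union_left
    · have nP : ¬ XT C.X P H := fun h => hx (h.mono Set.subset_union_left subset_rfl)
      have nQ : ¬ XT C.X Q H := fun h => hx (h.mono Set.subset_union_right subset_rfl)
      have dA : ∀ S : Set C.V, S ⊆ Aᶜ → ∀ x ∈ A, x ∉ S := fun S hS x hx h => hS h hx
      have cov : ∀ x, x ∈ A1 ∨ x ∈ A2 ∨ x ∈ P ∨ x ∈ Q ∨ x ∈ H := by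
        intro x
        have e1 := hA x
        have e2 := hB x
        simp only [Set.mem_compl_iff] at e2
        tauto
      rcases hn with ⟨n1, n2⟩ | ⟨n1, n2⟩
      · refine obs_wheel C hC A2 A1 P Q H ?_ ?_ ?_ ?_ ?_ c2 c1 cP cQ cH x12.symm xPQ
          (hno _ _ s2 sP) (hno _ _ s2 sQ) (hno _ _ s1 sP) (hno _ _ s1 sQ) (hno _ _ s2 sH)
          (hno _ _ s1 sH) nP nQ (tch _ _ n1) (tch _ _ n2) (tch _ _ nH2) (tch _ _ nH1) tPH tQH
        · intro x; have := cov x; tauto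
        · exact fun x hx => ⟨fun h => d12 x h hx, dA P sP x (s2 hx), dA Q sQ x (s2 hx),
            dA H sH x (s2 hx)⟩
        · exact fun x hx => ⟨dA P sP x (s1 hx), dA Q sQ x (s1 hx), dA H sH x (s1 hx)⟩
        · exact fun x hx => ⟨(hd x hx).2, (hd x hx).1⟩
        · exact fun x hx h => hd' x h hx
      · refine obs_wheel C hC A1 A2 P Q H ?_ ?_ ?_ ?_ ?_ c1 c2 cP cQ cH x12 xPQ
          (hno _ _ s1 sP) (hno _ _ s1 sQ) (hno _ _ s2 sP) (hno _ _ s2 sQ) (hno _ _ s1 sH)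
          (hno _ _ s2 sH) nP nQ (tch _ _ n1) (tch _ _ n2) (tch _ _ nH1) (tch _ _ nH2) tPH tQH
        · intro x; have := cov x; tauto
        · exact fun x hx => ⟨fun h => d12 x hx h, dA P sP x (s1 hx), dA Q sQ x (s1 hx),
            dA H sH x (s1 hx)⟩
        · exact fun x hx => ⟨dA P sP x (s2 hx), dA Q sQ x (s2 hx), dA H sH x (s2 hx)⟩
        · exact fun x hx => ⟨(hd x hx).2, (hd x hx).1⟩
        · exact fun x hx h => hd' x h hx

end LemmaM

section Cut

theorem cmpo_min {V : Type*} {G : SimpleGraph V} {S T : Set V} {v : V} (hT : T ⊆ S) (hv : v ∈ T)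
    (hc : Clo G S T) : cmpo G S v ⊆ T := fun _ hw => hw T hT hv hc

theorem cmpo_eq {V : Type*} {G : SimpleGraph V} {S : Set V} {a b : V} (ha : a ∈ S)
    (hb : b ∈ cmpo G S a) : cmpo G S b = cmpo G S a := by
  apply Set.Subset.antisymm
  · exact cmpo_min (cmpo_sub ha) hb cmpo_clo
  · exact (cmpo_cn ha).sub_of_clo (cmpo_sub ha) cmpo_clo hb mem_cmpo

/-- A separation of the constraint into two nonempty connected sides. -/
structure Cond (C : CGraph) (A : Set C.V) : Prop where
  cA : Cn C.G A
  cB : Cn C.G Aᶜ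
  sep : ∀ x y, s(x, y) ∈ C.X → (x ∈ A ↔ y ∈ A)
  eA : ∃ a b, a ∈ A ∧ b ∈ A ∧ s(a, b) ∈ C.X
  eB : ∃ a b, a ∉ A ∧ b ∉ A ∧ s(a, b) ∈ C.X

theorem Cond.swap {C : CGraph} {A : Set C.V} (h : Cond C A) : Cond C Aᶜ where
  cA := h.cB
  cB := by rw [compl_compl]; exact h.cA
  sep := fun x y hxy => not_congr (h.sep x y hxy)
  eA := h.eB
  eB := by
    obtain ⟨a, b, ha, hb, hab⟩ := h.eA
    exact ⟨a, b, fun h => h ha, fun h => h hb, hab⟩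

/-- Every proper component of `B \ y` receives a constraint edge from `y`. -/
def StarX (C : CGraph) (B : Set C.V) : Prop :=
  ∀ y ∈ B, ∀ w ∈ B \ {y}, cmpo C.G (B \ {y}) w ≠ B \ {y} →
    ∃ t ∈ cmpo C.G (B \ {y}) w, s(y, t) ∈ C.X

theorem lemmaCut (C : CGraph) (hC : C.WF) (h3 : ∀ x y, Cn C.G ({x, y}ᶜ : Set C.V)) (A : Set C.V)
    (h : Cond C A) (hst : StarX C Aᶜ) {c k : C.V} (hc : c ∈ A) (hck : s(c, k) ∈ C.X)
    (hcut : ¬ Cn C.G (A \ {c})) : HasObs C := by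
  classical
  have hadj : C.G.Adj c k := hC hck
  have hk : k ∈ A := (h.sep c k hck).1 hc
  have hk' : k ∈ A \ {c} := ⟨hk, hadj.ne'⟩
  set K := cmpo C.G (A \ {c}) k with hK
  have hKs : K ⊆ A \ {c} := cmpo_sub hk'
  have hcK : c ∉ K := fun h => (hKs h).2 rfl
  have hkK : k ∈ K := mem_cmpo
  have hKc : Clo C.G (A \ {c}) K := cmpo_clo
  have hz : ∃ z ∈ A \ {c}, z ∉ K := by
    by_contra hno
    push Not at hno
    have : K = A \ {c} := Set.Subset.antisymm hKs hno
    exact hcut (this ▸ cmpo_cn hk')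
  obtain ⟨z, hz, hzK⟩ := hz
  -- every vertex deletion leaves a component seeing both parts
  have F : ∀ y ∈ Aᶜ, ∃ w ∈ Aᶜ \ {y}, (∃ n ∈ cmpo C.G (Aᶜ \ {y}) w, n ∈ Nb C.G K) ∧
      (∃ n ∈ cmpo C.G (Aᶜ \ {y}) w, n ∈ Nb C.G (A \ K)) := by
    intro y hy
    by_contra hno
    push Not at hno
    let T : Set C.V := K ∪ {w | w ∈ Aᶜ \ {y} ∧ ∃ n ∈ cmpo C.G (Aᶜ \ {y}) w, n ∈ Nb C.G K}
    have hTs : T ⊆ ({c, y}ᶜ : Set C.V) := by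
      rintro x (hx | hx) (rfl | hxy)
      · exact hcK hx
      · rw [Set.mem_singleton_iff.1 hxy] at hx
        exact hy (hKs hx).1
      · exact hx.1.1 hc
      · exact hx.1.2 hxy
    have hTc : Clo C.G ({c, y}ᶜ : Set C.V) T := by
      intro a ha b hb hab
      have hbc : b ≠ c := fun h => hb (Or.inl h)
      have hby : b ≠ y := fun h => hb (Or.inr h)
      rcases ha with ha | ⟨ha, n, hn, hnN⟩
      · by_cases hbA : b ∈ A
        · exact Or.inl (hKc a ha b ⟨hbA, hbc⟩ hab)
        · exact Or.inr ⟨⟨hbA, hby⟩, b, mem_cmpo, a, ha, hab⟩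
      · by_cases hbA : b ∈ A
        · by_cases hbK : b ∈ K
          · exact Or.inl hbK
          · exact absurd (show a ∈ Nb C.G (A \ K) from ⟨b, ⟨hbA, hbK⟩, hab.symm⟩)
              (hno a ha ⟨n, hn, hnN⟩ a mem_cmpo)
        · have hb' : b ∈ Aᶜ \ {y} := ⟨hbA, hby⟩
          have : b ∈ cmpo C.G (Aᶜ \ {y}) a := cmpo_clo a mem_cmpo b hb' hab
          exact Or.inr ⟨hb', n, by rw [cmpo_eq ha this]; exact hn, hnN⟩
    have hzT : z ∈ T := (h3 c y).2 T hTs ⟨k, Or.inl hkK⟩ hTc (by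
      rintro (h1 | h1)
      · exact hz.2 h1
      · exact hy (h1 ▸ hz.1))
    rcases hzT with h1 | h1
    · exact hzK h1
    · exact h1.1.1 hz.1
  let Q : ℕ → Prop := fun n => ∃ y ∈ Aᶜ, ∃ t ∈ Aᶜ \ {y}, s(y, t) ∈ C.X ∧
    (∃ n ∈ cmpo C.G (Aᶜ \ {y}) t, n ∈ Nb C.G K) ∧
    (∃ n ∈ cmpo C.G (Aᶜ \ {y}) t, n ∈ Nb C.G (A \ K)) ∧ (cmpo C.G (Aᶜ \ {y}) t).ncard = n
  have hQ : ∃ n, Q n := by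
    obtain ⟨y, t0, hy, ht0, hyt⟩ := h.eB
    obtain ⟨w, hw, hw1, hw2⟩ := F y hy
    have : ∃ t ∈ cmpo C.G (Aᶜ \ {y}) w, s(y, t) ∈ C.X := by
      by_cases hW : cmpo C.G (Aᶜ \ {y}) w = Aᶜ \ {y}
      · rw [hW]
        have : C.G.Adj y t0 := hC hyt
        exact ⟨t0, ⟨ht0, this.ne'⟩, hyt⟩
      · exact hst y hy w hw hW
    obtain ⟨t, ht, hxt⟩ := this
    have e := cmpo_eq hw ht
    exact ⟨_, y, hy, t, cmpo_sub hw ht, hxt, by rw [e]; exact hw1, by rw [e]; exact hw2, rfl⟩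
  obtain ⟨y, hy, t, ht, hyt, hW1, hW2, hcard⟩ := Nat.find_spec hQ
  have hmin : ∀ y ∈ Aᶜ, ∀ t ∈ Aᶜ \ {y}, s(y, t) ∈ C.X →
    (∃ n ∈ cmpo C.G (Aᶜ \ {y}) t, n ∈ Nb C.G K) →
    (∃ n ∈ cmpo C.G (Aᶜ \ {y}) t, n ∈ Nb C.G (A \ K)) →
      Nat.find hQ ≤ (cmpo C.G (Aᶜ \ {y}) t).ncard := by
    intro y hy t ht h1 h2 h4
    exact Nat.find_min' hQ ⟨y, hy, t, ht, h1, h2, h4, rfl⟩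
  rw [← hcard] at hmin
  clear hcard
  set W := cmpo C.G (Aᶜ \ {y}) t with hW
  have hyt' : C.G.Adj y t := hC hyt
  have hgood : ∀ N : Set C.V, (∃ n ∈ W, n ∈ N) → (∀ y ∈ Aᶜ, ∃ w ∈ Aᶜ \ {y},
      (∃ n ∈ cmpo C.G (Aᶜ \ {y}) w, n ∈ N) ∧
      (∃ n ∈ cmpo C.G (Aᶜ \ {y}) w, n ∈ Nb C.G K) ∧
      (∃ n ∈ cmpo C.G (Aᶜ \ {y}) w, n ∈ Nb C.G (A \ K))) → Good C.G Aᶜ y t N := by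
    intro N hN hF y' hy' T hT hTc hor
    by_cases hyy : y' = y
    · subst hyy
      have htT : t ∈ T := by
        rcases hor with h1 | h1
        · exact absurd rfl (hT h1).2
        · exact h1
      obtain ⟨n, hn, hnN⟩ := hN
      exact ⟨n, cmpo_min hT htT hTc hn, hnN⟩
    · have hyT : y ∈ T := by
        rcases hor with h1 | h1
        · exact h1
        · exact hTc t h1 y ⟨hy, fun h => hyy h.symm⟩ hyt'.symm
      by_cases hyW : y' ∈ W
      · by_contra hno
        obtain ⟨w, hw, hwN, hw1, hw2⟩ := hF y' hy'
        set U := cmpo C.G (Aᶜ \ {y'}) w with hU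
        have hUs : U ⊆ Aᶜ \ {y'} := cmpo_sub hw
        have hUcn : Cn C.G U := cmpo_cn hw
        have hyU : y ∉ U := by
          intro hyU
          obtain ⟨n, hn, hnN⟩ := hwN
          exact hno ⟨n, hUcn.sub_of_clo hUs hTc hyU hyT hn, hnN⟩
        have hUne : U ≠ Aᶜ \ {y'} := by
          intro he
          exact hyU (he ▸ ⟨hy, fun h => hyy h.symm⟩)
        obtain ⟨t', ht', hxt'⟩ := hst y' hy' w hw hUne
        have hUW : U ⊆ W := by
          have hUs' : U ⊆ Aᶜ \ {y} := fun x hx => ⟨(hUs hx).1, fun h => hyU (h ▸ hx)⟩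
          have : t' ∈ W := cmpo_clo y' hyW t' (hUs' ht') (hC hxt')
          exact hUcn.sub_of_clo hUs' cmpo_clo ht' this
        have e := cmpo_eq hw ht'
        have h5 := hmin y' hy' t' (hUs ht') hxt' (by rw [e]; exact hw1) (by rw [e]; exact hw2)
        rw [e] at h5
        have h6 : U.ncard < W.ncard := by
          apply Set.ncard_lt_ncard _ (Set.toFinite _)
          refine ⟨hUW, fun h7 => ?_⟩
          exact (hUs (h7 hyW)).2 rfl
        exact absurd h5 (not_le.2 h6)
      · have hWs : W ⊆ Aᶜ \ {y'} := fun x hx =>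
          ⟨(cmpo_sub ht hx).1, fun h => hyW (h ▸ hx)⟩
        have htW : t ∈ W := mem_cmpo
        have htT : t ∈ T := hTc y hyT t (hWs htW) hyt'
        obtain ⟨n, hn, hnN⟩ := hN
        exact ⟨n, (cmpo_cn ht).sub_of_clo hWs hTc htW htT hn, hnN⟩
  refine lemmaM C hC A K (A \ K) ?_ ?_ (cmpo_cn hk') (cn_diff_cmpo h.cA hc hk') h.cB h.sep
    ⟨k, hkK, c, ⟨hc, hcK⟩, by rwa [Sym2.eq_swap]⟩ hy ht.1 hyt ?_ ?_
  · intro x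
    constructor
    · intro hx
      by_cases hxK : x ∈ K
      · exact Or.inl hxK
      · exact Or.inr ⟨hx, hxK⟩
    · rintro (hx | hx)
      · exact (hKs hx).1
      · exact hx.1
  · exact fun x hx h => h.2 hx
  · apply hgood _ hW1
    intro y hy
    obtain ⟨w, hw, h1, h2⟩ := F y hy
    exact ⟨w, hw, h1, h1, h2⟩
  · apply hgood _ hW2
    intro y hy
    obtain ⟨w, hw, h1, h2⟩ := F y hy
    exact ⟨w, hw, h2, h1, h2⟩

end Cut

section Stages

theorem Cond.move {C : CGraph} {A M : Set C.V} (h : Cond C A) (hM : M ⊆ A) (cM : Cn C.G M)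
    (cAM : Cn C.G (A \ M)) (ht : Tch C.G M Aᶜ)
    (hx : ∀ x ∈ M, ∀ y ∈ A \ M, s(x, y) ∉ C.X)
    (he : ∃ a b, a ∈ A \ M ∧ b ∈ A \ M ∧ s(a, b) ∈ C.X) : Cond C (A \ M) where
  cA := cAM
  cB := by
    have e : (A \ M)ᶜ = M ∪ Aᶜ := by
      ext x
      by_cases h1 : x ∈ A <;> by_cases h2 : x ∈ M <;> simp [h1, h2]
    rw [e]
    exact cM.union h.cB ht
  sep := by
    intro x y hxy
    have hA := h.sep x y hxy
    constructor
    · rintro ⟨h1, h2⟩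
      refine ⟨hA.1 h1, fun h3 => hx y h3 x ⟨h1, h2⟩ ?_⟩
      rwa [Sym2.eq_swap]
    · rintro ⟨h1, h2⟩
      exact ⟨hA.2 h1, fun h3 => hx x h3 y ⟨h1, h2⟩ hxy⟩
  eA := he
  eB := by
    obtain ⟨a, b, ha, hb, hab⟩ := h.eB
    exact ⟨a, b, fun h => ha h.1, fun h => hb h.1, hab⟩

theorem Cond.touch {C : CGraph} (h3 : ∀ x y, Cn C.G ({x, y}ᶜ : Set C.V)) {A : Set C.V}
    (h : Cond C A) {y w : C.V} (hy : y ∈ A) (hw : w ∈ A \ {y}) :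
    Tch C.G (cmpo C.G (A \ {y}) w) Aᶜ := by
  by_contra hno
  have hs := cmpo_sub (G := C.G) hw
  obtain ⟨b, hb⟩ := h.cB.1
  have := (h3 y y).2 (cmpo C.G (A \ {y}) w) (fun x hx h => by
    rcases h with h | h
    · exact (hs hx).2 h
    · exact (hs hx).2 h) ⟨w, mem_cmpo⟩ (by
    intro a ha c hc hac
    by_cases hcA : c ∈ A
    · exact cmpo_clo a ha c ⟨hcA, fun h => hc (Or.inl h)⟩ hac
    · exact absurd ⟨a, ha, c, hcA, hac⟩ hno)
  have hbb : b ∈ ({y, y}ᶜ : Set C.V) := by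
    rintro (h | h)
    · exact hb (h ▸ hy)
    · exact hb ((Set.mem_singleton_iff.1 h) ▸ hy)
  exact hb (hs (this hbb)).1

theorem stage_one {C : CGraph} (hC : C.WF) (h3 : ∀ x y, Cn C.G ({x, y}ᶜ : Set C.V)) {A : Set C.V}
    (h : Cond C A) (hmin : ∀ M ⊆ A, M.Nonempty → ¬ Cond C (A \ M)) : StarX C A := by
  intro y hy w hw hne
  by_contra hno
  push Not at hno
  set Z := cmpo C.G (A \ {y}) w with hZ
  have hZs : Z ⊆ A \ {y} := cmpo_sub hw
  have hZx : ∀ x ∈ Z, ∀ u ∈ A \ Z, s(x, u) ∉ C.X := by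
    intro x hx u hu hxu
    by_cases huy : u = y
    · subst huy
      exact hno x hx (by rwa [Sym2.eq_swap])
    · exact hu.2 (cmpo_clo x hx u ⟨hu.1, huy⟩ (hC hxu))
  by_cases he : ∃ a b, a ∈ A \ Z ∧ b ∈ A \ Z ∧ s(a, b) ∈ C.X
  · exact hmin Z (fun x hx => (hZs hx).1) ⟨w, mem_cmpo⟩
      (h.move (fun x hx => (hZs hx).1) (cmpo_cn hw) (cn_diff_cmpo h.cA hy hw)
        (h.touch h3 hy hw) hZx he)
  · have hin : ∀ a b, a ∈ A → s(a, b) ∈ C.X → a ∈ Z := by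
      intro a b ha hab
      by_contra haZ
      have hb := (h.sep a b hab).1 ha
      by_cases hbZ : b ∈ Z
      · exact hZx b hbZ a ⟨ha, haZ⟩ (by rwa [Sym2.eq_swap])
      · exact he ⟨a, b, ⟨ha, haZ⟩, ⟨hb, hbZ⟩, hab⟩
    have : ∃ z ∈ A \ {y}, z ∉ Z := by
      by_contra hcon
      push Not at hcon
      exact hne (Set.Subset.antisymm hZs hcon)
    obtain ⟨z, hz, hzZ⟩ := this
    set M := cmpo C.G (A \ {y}) z with hM
    have hMs : M ⊆ A \ {y} := cmpo_sub hz
    have hdis : ∀ x ∈ Z, x ∉ M := fun x hx hxM =>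
      hzZ ((cmpo_cn hz).sub_of_clo hMs cmpo_clo hxM hx mem_cmpo)
    refine hmin M (fun x hx => (hMs hx).1) ⟨z, mem_cmpo⟩
      (h.move (fun x hx => (hMs hx).1) (cmpo_cn hz) (cn_diff_cmpo h.cA hy hz)
        (h.touch h3 hy hz) ?_ ?_)
    · intro x hx u _ hxu
      exact hdis x (hin x u (hMs hx).1 hxu) hx
    · obtain ⟨a, b, ha, hb, hab⟩ := h.eA
      have haZ := hin a b ha hab
      have hbZ := hin b a hb (by rwa [Sym2.eq_swap])
      exact ⟨a, b, ⟨ha, hdis a haZ⟩, ⟨hb, hdis b hbZ⟩, hab⟩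

/-- No constraint-covered vertex is a cutvertex of the side `A`. -/
def NC (C : CGraph) (A : Set C.V) : Prop :=
  ∀ c ∈ A, (∃ k, s(c, k) ∈ C.X) → Cn C.G (A \ {c})

/-- The side `A` has no cutvertex. -/
def TwoC (C : CGraph) (A : Set C.V) : Prop := ∀ x ∈ A, Cn C.G (A \ {x})

theorem shrink_step {C : CGraph} (hC : C.WF) (h3 : ∀ x y, Cn C.G ({x, y}ᶜ : Set C.V))
    {A : Set C.V} (h : Cond C A) (hn : NC C A) {r : C.V} (hr : r ∈ A) (hcut : ¬ Cn C.G (A \ {r})) :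
    ∃ M ⊆ A, M.Nonempty ∧ Cond C (A \ M) ∧ NC C (A \ M) ∧ (TwoC C Aᶜ → TwoC C (A \ M)ᶜ) := by
  obtain ⟨a, a', ha, ha', haa⟩ := h.eA
  have hrx : ∀ k, s(r, k) ∉ C.X := fun k hk => hcut (hn r hr ⟨k, hk⟩)
  have har : a ∈ A \ {r} := ⟨ha, fun h => hrx a' (by rw [← Set.mem_singleton_iff.1 h]; exact haa)⟩
  have har' : a' ∈ A \ {r} := ⟨ha', fun h => hrx a (by
    rw [← Set.mem_singleton_iff.1 h, Sym2.eq_swap]; exact haa)⟩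
  have : ∃ z ∈ A \ {r}, z ∉ cmpo C.G (A \ {r}) a := by
    by_contra hno
    push Not at hno
    have e : cmpo C.G (A \ {r}) a = A \ {r} := Set.Subset.antisymm (cmpo_sub har) hno
    exact hcut (e ▸ cmpo_cn har)
  obtain ⟨z, hz, hzZ⟩ := this
  set M := cmpo C.G (A \ {r}) z with hM
  have hMs : M ⊆ A \ {r} := cmpo_sub hz
  have hMA : M ⊆ A := fun x hx => (hMs hx).1
  have hMc : Clo C.G (A \ {r}) M := cmpo_clo
  have haM : a ∉ M := fun haM =>
    hzZ ((cmpo_cn hz).sub_of_clo hMs cmpo_clo haM mem_cmpo mem_cmpo)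
  have haM' : a' ∉ M := fun h => haM (hMc a' h a har (hC haa : C.G.Adj a a').symm)
  refine ⟨M, hMA, ⟨z, mem_cmpo⟩, ?_, ?_, ?_⟩
  · refine h.move hMA (cmpo_cn hz) (cn_diff_cmpo h.cA hr hz) (h.touch h3 hr hz) ?_
      ⟨a, a', ⟨ha, haM⟩, ⟨ha', haM'⟩, haa⟩
    intro x hx u hu hxu
    by_cases hur : u = r
    · subst hur
      exact hrx x (by rwa [Sym2.eq_swap])
    · exact hu.2 (hMc x hx u ⟨hu.1, hur⟩ (hC hxu))
  · intro c hc hcx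
    have hcr : r ≠ c := by
      rintro rfl
      obtain ⟨k, hk⟩ := hcx
      exact hrx k hk
    have hcn := hn c hc.1 hcx
    refine cn_of_root (b := r) ⟨⟨hr, fun h => (hMs h).2 rfl⟩, hcr⟩ ?_
    intro T hT hne hcl
    by_contra hrT
    refine hrT (hcn.2 T (fun x hx => ⟨(hT hx).1.1, (hT hx).2⟩) hne ?_ ⟨hr, hcr⟩)
    intro x hx b hb hxb
    by_cases hbM : b ∈ M
    · exact absurd (hMc b hbM x ⟨(hT hx).1.1, fun h => hrT (h ▸ hx)⟩ hxb.symm) (hT hx).1.2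
    · exact hcl x hx b ⟨⟨hb.1, hbM⟩, hb.2⟩ hxb
  · intro h2 y hy
    have hD : Cn C.G (Aᶜ \ {y}) := by
      by_cases hyA : y ∈ A
      · have : Aᶜ \ {y} = Aᶜ := by
          ext x
          constructor
          · exact fun h => h.1
          · exact fun h => ⟨h, fun e => h (Set.mem_singleton_iff.1 e ▸ hyA)⟩
        rw [this]
        exact h.cB
      · exact h2 y hyA
    obtain ⟨d, hd⟩ := hD.1
    have hDs : Aᶜ \ {y} ⊆ (A \ M)ᶜ \ {y} := fun x hx => ⟨fun h => hx.1 h.1, hx.2⟩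
    refine cn_of_root (b := d) (hDs hd) ?_
    intro T hT hne hcl
    by_contra hdT
    have hTD : ∀ x ∈ T, x ∈ M := by
      intro x hx
      by_contra hxM
      have hxA : x ∉ A := fun hxA => (hT hx).1 ⟨hxA, hxM⟩
      exact hdT (hD.sub_of_clo hDs hcl ⟨hxA, (hT hx).2⟩ hx hd)
    refine hdT ((h3 y r).2 T ?_ hne ?_ ?_)
    · rintro x hx (h | h)
      · exact (hT hx).2 h
      · exact (hMs (hTD x hx)).2 h
    · intro x hx b hb hxb
      have hby : b ∉ ({y} : Set C.V) := fun h => hb (Or.inl h)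
      by_cases hbA : b ∈ A
      · have := hMc x (hTD x hx) b ⟨hbA, fun h => hb (Or.inr h)⟩ hxb
        exact hcl x hx b ⟨fun h => h.2 this, hby⟩ hxb
      · exact hcl x hx b ⟨fun h => hbA h.1, hby⟩ hxb
    · rintro (h | h)
      · exact hd.2 h
      · exact hd.1 (Set.mem_singleton_iff.1 h ▸ hr)

theorem shrink {C : CGraph} (hC : C.WF) (h3 : ∀ x y, Cn C.G ({x, y}ᶜ : Set C.V))
    {A : Set C.V} (h : Cond C A) (hn : NC C A) :
    ∃ A', Cond C A' ∧ TwoC C A' ∧ (TwoC C Aᶜ → TwoC C A'ᶜ) := by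
  induction hk : A.ncard using Nat.strong_induction_on generalizing A with
  | _ k ih =>
    by_cases h2 : TwoC C A
    · exact ⟨A, h, h2, id⟩
    · unfold TwoC at h2
      push Not at h2
      obtain ⟨r, hr, hcut⟩ := h2
      obtain ⟨M, hMA, hMne, h1, h2, h4⟩ := shrink_step hC h3 h hn hr hcut
      have hlt : (A \ M).ncard < k := by
        rw [← hk]
        apply Set.ncard_lt_ncard _ (Set.toFinite _)
        refine ⟨Set.sdiff_subset, fun hs => ?_⟩
        obtain ⟨m, hm⟩ := hMne
        exact (hs (hMA hm)).2 hm
      obtain ⟨A', h5, h6, h7⟩ := ih _ hlt h1 h2 rfl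
      exact ⟨A', h5, h6, fun h => h7 (h4 h)⟩

theorem TwoC.star {C : CGraph} {A : Set C.V} (h : TwoC C A) : StarX C A := by
  intro y hy w hw hne
  exact absurd ((h y hy).eq_of_clo (cmpo_sub hw) ⟨w, mem_cmpo⟩ cmpo_clo) hne

theorem exists_twoC {C : CGraph} (hC : C.WF) (h3 : ∀ x y, Cn C.G ({x, y}ᶜ : Set C.V))
    {A : Set C.V} (h : Cond C A) :
    HasObs C ∨ ∃ A, Cond C A ∧ TwoC C A ∧ TwoC C Aᶜ := by
  classical
  by_contra hcon
  push Not at hcon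
  obtain ⟨hobs, hcon⟩ := hcon
  have hQ : ∃ n, ∃ A, Cond C A ∧ A.ncard = n := ⟨_, A, h, rfl⟩
  obtain ⟨B, hB, hBn⟩ := Nat.find_spec hQ
  have hmin : ∀ M ⊆ B, M.Nonempty → ¬ Cond C (B \ M) := by
    intro M hM hne hc
    have h1 := Nat.find_min' hQ ⟨B \ M, hc, rfl⟩
    rw [← hBn] at h1
    refine absurd h1 (not_le.2 ?_)
    apply Set.ncard_lt_ncard _ (Set.toFinite _)
    refine ⟨Set.sdiff_subset, fun hs => ?_⟩
    obtain ⟨m, hm⟩ := hne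
    exact (hs (hM hm)).2 hm
  have hst := stage_one hC h3 hB hmin
  have hNC : ∀ A, Cond C A → StarX C Aᶜ → NC C A := by
    intro A hA hs c hc hcx
    by_contra hcut
    obtain ⟨k, hk⟩ := hcx
    exact hobs (lemmaCut C hC h3 A hA hs hc hk hcut)
  obtain ⟨A1, h1, h2, -⟩ := shrink hC h3 hB.swap (hNC _ hB.swap (by rwa [compl_compl]))
  obtain ⟨A2, h4, h5, h6⟩ := shrink hC h3 h1.swap
    (hNC _ h1.swap (by rw [compl_compl]; exact h2.star))
  exact hcon A2 h4 h5 (h6 (by rwa [compl_compl]))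

end Stages

section Final

theorem twoC_small {C : CGraph} (hC : C.WF) (h3 : ∀ x y, Cn C.G ({x, y}ᶜ : Set C.V))
    {A : Set C.V} (h : Cond C A) (h2 : TwoC C Aᶜ) (hcard : A.ncard ≤ 2) : HasObs C := by
  obtain ⟨a₁, a₂, ha₁, ha₂, ha⟩ := h.eA
  obtain ⟨b₁, b₂, hb₁, hb₂, hb⟩ := h.eB
  have hane : a₁ ≠ a₂ := (hC ha : C.G.Adj a₁ a₂).ne
  have hbne : b₁ ≠ b₂ := (hC hb : C.G.Adj b₁ b₂).ne
  have hAe : ({a₁, a₂} : Set C.V) = A := by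
    apply Set.eq_of_subset_of_ncard_le _ _ (Set.toFinite _)
    · rintro x (rfl | hx)
      · exact ha₁
      · rw [Set.mem_singleton_iff.1 hx]; exact ha₂
    · rw [Set.ncard_pair hane]; exact hcard
  have hgood : ∀ a a', a ≠ a' → A = {a, a'} → Good C.G Aᶜ b₁ b₂ (Nb C.G {a}) := by
    intro a a' hne hAa y hy T hT hcl hor
    have haA : a ∈ A := by rw [hAa]; exact Or.inl rfl
    have haA' : a' ∈ A := by rw [hAa]; exact Or.inr rfl
    have hTe : T = Aᶜ \ {y} := by
      apply (h2 y hy).eq_of_clo hT _ hcl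
      rcases hor with h | h
      · exact ⟨_, h⟩
      · exact ⟨_, h⟩
    rw [hTe]
    by_contra hno
    have hsub := (h3 a' y).2 {a} (by
      rintro x hx (h | h)
      · exact hne (by rw [← h, Set.mem_singleton_iff.1 hx])
      · exact hy (by rw [← Set.mem_singleton_iff.1 h, Set.mem_singleton_iff.1 hx]; exact haA))
      ⟨a, rfl⟩ (by
      intro x hx b hb' hxb
      rw [Set.mem_singleton_iff.1 hx] at hxb
      by_cases hbA : b ∈ A
      · rw [hAa] at hbA
        rcases hbA with h | h
        · exact h
        · exact absurd (Or.inl h) hb'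
      · exact absurd ⟨b, ⟨hbA, fun h => hb' (Or.inr h)⟩, a, rfl, hxb⟩ hno)
    have key : ∀ b, b ∉ A → b ≠ y → False := by
      intro b hbA hby
      have : b ∈ ({a} : Set C.V) := hsub (by
        rintro (h | h)
        · exact hbA (h ▸ haA')
        · exact hby h)
      exact hbA (Set.mem_singleton_iff.1 this ▸ haA)
    by_cases h1 : b₁ = y
    · exact key b₂ hb₂ (fun h => hbne (h1.trans h.symm))
    · exact key b₁ hb₁ h1
  refine lemmaM C hC A {a₁} {a₂} ?_ ?_ (cn_singleton _) (cn_singleton _) h.cB h.sep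
    ⟨a₁, rfl, a₂, rfl, ha⟩ hb₁ hb₂ hb (hgood a₁ a₂ hane hAe.symm)
    (hgood a₂ a₁ hane.symm (by rw [← hAe, Set.pair_comm]))
  · intro x
    rw [← hAe]
    exact Iff.rfl
  · intro x hx hx'
    exact hane ((Set.mem_singleton_iff.1 hx).symm.trans (Set.mem_singleton_iff.1 hx'))

theorem rooted_sorted {V : Type} [Finite V] {G : SimpleGraph V} {X : Set (Sym2 V)} {A : Set V}
    {a a' : V} {g : V → ℤ} (hg : STLab G A a a' g) (ha : a ∈ A) (ha' : a' ∈ A)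
    (hX : s(a, a') ∈ X) (hadj : G.Adj a a') (x : Fin 3 → V) (hx : ∀ i, x i ∈ A)
    (h01 : g (x 0) < g (x 1)) (h12 : g (x 1) < g (x 2)) :
    ∃ P : Fin 3 → Set V, (∀ v, v ∈ A ↔ ∃ i, v ∈ P i) ∧ (∀ i j v, v ∈ P i → v ∈ P j → i = j) ∧
      (∀ i, Cn G (P i)) ∧ (∀ i j, i ≠ j → Tch G (P i) (P j)) ∧
      (∃ i j, i ≠ j ∧ XT X (P i) (P j)) ∧ ∀ i, x i ∈ P i := by
  have hm := hg.min_le (hx 0)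
  have hM := hg.le_max (hx 2)
  obtain ⟨v, hv, v', hv', hvv, e1, e2⟩ := hg.low (x 1) (hx 1) (by omega)
  obtain ⟨w, hw, w', hw', hww, e3, e4⟩ := hg.high (x 1) (hx 1) (by omega)
  set t := g (x 1) with ht
  have t01 : Tch G {v | v ∈ A ∧ g v ≤ t - 1} {v | v ∈ A ∧ g v = t} :=
    ⟨v', ⟨hv', by omega⟩, v, ⟨hv, e1⟩, hvv.symm⟩
  have t12 : Tch G {v | v ∈ A ∧ g v = t} {v | v ∈ A ∧ t + 1 ≤ g v} :=
    ⟨w, ⟨hw, e3⟩, w', ⟨hw', by omega⟩, hww⟩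
  have t02 : Tch G {v | v ∈ A ∧ g v ≤ t - 1} {v | v ∈ A ∧ t + 1 ≤ g v} :=
    ⟨a, ⟨ha, by omega⟩, a', ⟨ha', by omega⟩, hadj⟩
  refine ⟨![{v | v ∈ A ∧ g v ≤ t - 1}, {v | v ∈ A ∧ g v = t}, {v | v ∈ A ∧ t + 1 ≤ g v}],
    ?_, ?_, ?_, ?_, ?_, ?_⟩
  · intro u
    constructor
    · intro hu
      rcases lt_trichotomy (g u) t with h | h | h
      · exact ⟨0, hu, by omega⟩
      · exact ⟨1, hu, h⟩
      · exact ⟨2, hu, by omega⟩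
    · rintro ⟨i, hi⟩
      fin_cases i <;> exact hi.1
  · intro i j u hi hj
    fin_cases i <;> fin_cases j <;> first
      | rfl
      | (exfalso
         have h1 := hi.2
         have h2 := hj.2
         omega)
  · intro i
    fin_cases i
    · exact hg.initSeg ha (by omega)
    · exact hg.fib (x 1) (hx 1)
    · exact hg.tailSeg ha' (by omega)
  · intro i j hij
    fin_cases i <;> fin_cases j
    · exact absurd rfl hij
    · exact t01
    · exact t02
    · exact t01.symm
    · exact absurd rfl hij
    · exact t12
    · exact t02.symm
    · exact t12.symm
    · exact absurd rfl hij
  · exact ⟨0, 2, by decide, a, ⟨ha, by omega⟩, a', ⟨ha', by omega⟩, hX⟩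
  · intro i
    fin_cases i
    · exact ⟨hx 0, by show g (x 0) ≤ t - 1; omega⟩
    · exact ⟨hx 1, rfl⟩
    · exact ⟨hx 2, by show t + 1 ≤ g (x 2); omega⟩

theorem rooted {C : CGraph} (hC : C.WF) {A : Set C.V} (h : Cond C A) (h2 : TwoC C A)
    (x : Fin 3 → C.V) (hx : ∀ i, x i ∈ A) (hinj : Function.Injective x) :
    ∃ P : Fin 3 → Set C.V, (∀ v, v ∈ A ↔ ∃ i, v ∈ P i) ∧
      (∀ i j v, v ∈ P i → v ∈ P j → i = j) ∧
      (∀ i, Cn C.G (P i)) ∧ (∀ i j, i ≠ j → Tch C.G (P i) (P j)) ∧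
      (∃ i j, i ≠ j ∧ XT C.X (P i) (P j)) ∧ ∀ i, x i ∈ P i := by
  obtain ⟨a, a', ha, ha', haa⟩ := h.eA
  have hadj : C.G.Adj a a' := hC haa
  obtain ⟨g, hg, hN⟩ := exists_STLab h.cA ha ha' hadj.ne
  have hgi : Function.Injective (g ∘ x) := by
    intro i j hij
    by_contra hne
    have hxne : x i ≠ x j := fun h => hne (hinj h)
    obtain ⟨p, _, q, _, hp, hq, hlt⟩ := hN {x i, x j} (by
      intro y hy T hT hcl hor
      have hTe : T = A \ {y} := by
        apply (h2 y hy).eq_of_clo hT _ hcl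
        rcases hor with h | h
        · exact ⟨_, h⟩
        · exact ⟨_, h⟩
      rw [hTe]
      by_cases hy1 : x i = y
      · exact ⟨x j, ⟨hx j, fun h => hxne (hy1.trans (Set.mem_singleton_iff.1 h).symm)⟩, Or.inr rfl⟩
      · exact ⟨x i, ⟨hx i, hy1⟩, Or.inl rfl⟩)
    have hij' : g (x i) = g (x j) := hij
    rcases hp with rfl | hp <;> rcases hq with rfl | hq
    · omega
    · rw [Set.mem_singleton_iff.1 hq] at hlt; omega
    · rw [Set.mem_singleton_iff.1 hp] at hlt; omega
    · rw [Set.mem_singleton_iff.1 hp, Set.mem_singleton_iff.1 hq] at hlt; omega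
  let σ := Tuple.sort (g ∘ x)
  have hmono : StrictMono ((g ∘ x) ∘ σ) :=
    (Tuple.monotone_sort (g ∘ x)).strictMono_of_injective (hgi.comp σ.injective)
  obtain ⟨P, p1, p2, p3, p4, p5, p6⟩ := rooted_sorted hg ha ha' haa hadj (x ∘ σ)
    (fun i => hx _) (hmono (by decide : (0 : Fin 3) < 1)) (hmono (by decide : (1 : Fin 3) < 2))
  refine ⟨fun i => P (σ.symm i), ?_, ?_, fun i => p3 _, ?_, ?_, ?_⟩
  · intro v
    rw [p1]
    constructor
    · rintro ⟨i, hi⟩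
      exact ⟨σ i, by simpa using hi⟩
    · rintro ⟨i, hi⟩
      exact ⟨_, hi⟩
  · intro i j v hi hj
    exact σ.symm.injective (p2 _ _ v hi hj)
  · intro i j hij
    exact p4 _ _ (fun h => hij (σ.symm.injective h))
  · obtain ⟨i, j, hij, hh⟩ := p5
    exact ⟨σ i, σ j, fun h => hij (σ.injective h), by simpa using hh⟩
  · intro i
    simpa using p6 (σ.symm i)

theorem three_edges {C : CGraph} (h3 : ∀ S : Set C.V, S.ncard < 3 → Cn C.G Sᶜ)
    {A : Set C.V} (hA : 3 ≤ A.ncard) (hB : 3 ≤ Aᶜ.ncard) :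
    ∃ x y : Fin 3 → C.V, (∀ i, x i ∈ A) ∧ (∀ i, y i ∉ A) ∧ Function.Injective x ∧
      Function.Injective y ∧ ∀ i, C.G.Adj (x i) (y i) := by
  classical
  have : Fintype C.V := Fintype.ofFinite _
  let N : A → Finset C.V := fun a => Finset.univ.filter (fun v => v ∉ A ∧ C.G.Adj a v)
  let t : A → Finset (C.V ⊕ Fin (A.ncard - 3)) := fun a => (N a).disjSum Finset.univ
  have hnA : Fintype.card A = A.ncard := by
    rw [← Nat.card_eq_fintype_card]; rfl
  have hall : ∀ S : Finset A, S.card ≤ (S.biUnion t).card := by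
    intro S
    rcases S.eq_empty_or_nonempty with rfl | ⟨s0, hs0⟩
    · simp
    have hsub : (S.biUnion N).disjSum (Finset.univ : Finset (Fin (A.ncard - 3))) ⊆ S.biUnion t := by
      intro z hz
      rw [Finset.mem_biUnion]
      rcases Finset.mem_disjSum.1 hz with ⟨v, hv, rfl⟩ | ⟨k, hk, rfl⟩
      · obtain ⟨s, hs, hv⟩ := Finset.mem_biUnion.1 hv
        exact ⟨s, hs, Finset.inl_mem_disjSum.2 hv⟩
      · exact ⟨s0, hs0, Finset.inr_mem_disjSum.2 (Finset.mem_univ _)⟩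
    refine le_trans ?_ (Finset.card_le_card hsub)
    rw [Finset.card_disjSum, Finset.card_univ, Fintype.card_fin]
    by_contra hlt
    push Not at hlt
    have hSle : S.card ≤ A.ncard := by rw [← hnA]; exact Finset.card_le_univ S
    let S' : Finset C.V := S.map (Function.Embedding.subtype _)
    let U : Set C.V := (A \ S') ∪ (S.biUnion N : Finset C.V)
    have hS'A : (S' : Set C.V) ⊆ A := by
      intro z hz
      obtain ⟨s, hs, rfl⟩ := Finset.mem_map.1 (Finset.mem_coe.1 hz)
      exact s.2
    have hU : U.ncard < 3 := by
      have h1 : U.ncard ≤ (A \ (S' : Set C.V)).ncard + ((S.biUnion N : Finset C.V) : Set C.V).ncard :=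
        Set.ncard_union_le _ _
      have h2 := Set.ncard_sdiff_add_ncard_of_subset hS'A (Set.toFinite _)
      rw [Set.ncard_coe_finset] at h1 h2
      rw [Finset.card_map] at h2
      omega
    have hcl := (h3 U hU).2 S' (by
      rintro z hz (h | h)
      · exact h.2 hz
      · obtain ⟨s, hs, hv⟩ := Finset.mem_biUnion.1 (Finset.mem_coe.1 h)
        exact (Finset.mem_filter.1 hv).2.1 (hS'A hz))
      ⟨s0, Finset.mem_coe.2 (Finset.mem_map.2 ⟨s0, hs0, rfl⟩)⟩ (by
      intro z hz b hb hzb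
      obtain ⟨s, hs, rfl⟩ := Finset.mem_map.1 (Finset.mem_coe.1 hz)
      by_contra hbS
      by_cases hbA : b ∈ A
      · exact hb (Or.inl ⟨hbA, hbS⟩)
      · exact hb (Or.inr (Finset.mem_coe.2 (Finset.mem_biUnion.2
          ⟨s, hs, Finset.mem_filter.2 ⟨Finset.mem_univ _, hbA, hzb⟩⟩))))
    have hsub2 : Aᶜ ⊆ U := by
      intro z hz
      by_contra hzU
      exact hz (hS'A (hcl hzU))
    have := Set.ncard_le_ncard hsub2 (Set.toFinite _)
    omega
  obtain ⟨f, hf, hft⟩ := (Finset.all_card_le_biUnion_card_iff_exists_injective t).1 hall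
  have hcard : Fintype.card (Fin 3) ≤ Fintype.card {a : A // ∃ v, f a = Sum.inl v} := by
    have h1 := Fintype.card_subtype_compl (fun a : A => ∃ v, f a = Sum.inl v)
    have h2 := Fintype.card_subtype_le (fun a : A => ∃ v, f a = Sum.inl v)
    have h4 : ∀ a : {a : A // ¬ ∃ v, f a = Sum.inl v}, ∃ k, f a.1 = Sum.inr k := by
      rintro ⟨a, ha⟩
      rcases hfa : f a with v | k
      · exact absurd ⟨v, hfa⟩ ha
      · exact ⟨k, rfl⟩
    choose k hk using h4
    have h5 := Fintype.card_le_of_injective k (fun a b hab => by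
      apply Subtype.ext
      apply hf
      rw [hk, hk, hab])
    rw [Fintype.card_fin] at h5 ⊢
    omega
  obtain ⟨e⟩ := Function.Embedding.nonempty_of_card_le hcard
  choose y hy using fun i => (e i).2
  have hyt : ∀ i, y i ∉ A ∧ C.G.Adj (e i).1 (y i) := by
    intro i
    have := hft (e i).1
    rw [hy i] at this
    exact (Finset.mem_filter.1 (Finset.inl_mem_disjSum.1 this)).2
  refine ⟨fun i => (e i).1, y, fun i => (e i).1.2, fun i => (hyt i).1, ?_, ?_, fun i => (hyt i).2⟩
  · intro i j hij
    exact e.injective (Subtype.ext (Subtype.ext hij))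
  · intro i j hij
    apply e.injective
    apply Subtype.ext
    apply hf
    rw [hy, hy, hij]

theorem twoC_obs {C : CGraph} (hC : C.WF) (h3 : ∀ S : Set C.V, S.ncard < 3 → Cn C.G Sᶜ)
    (h3' : ∀ x y, Cn C.G ({x, y}ᶜ : Set C.V))
    {A : Set C.V} (h : Cond C A) (hA : TwoC C A) (hB : TwoC C Aᶜ) : HasObs C := by
  by_cases h1 : A.ncard ≤ 2
  · exact twoC_small hC h3' h hB h1
  by_cases h2 : Aᶜ.ncard ≤ 2
  · exact twoC_small hC h3' h.swap (by rwa [compl_compl]) h2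
  obtain ⟨x, y, hx, hy, ix, iy, hxy⟩ := three_edges h3 (A := A) (by omega) (by omega)
  obtain ⟨P, p1, p2, p3, p4, p5, p6⟩ := rooted hC h hA x hx ix
  obtain ⟨Q, q1, q2, q3, q4, q5, q6⟩ := rooted hC h.swap hB y hy iy
  exact PP.obs hC (A := A) (P := P) (Q := Q) ⟨p1, q1, p2, q2, p3, q3, p4, q4,
    fun i => ⟨x i, p6 i, y i, q6 i, hxy i⟩, h.sep, p5, q5⟩

theorem cn_of_connected {V : Type} {G : SimpleGraph V} {S : Set V} (h : (G.induce S).Connected) :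
    Cn G S := by
  obtain ⟨⟨b, hb⟩⟩ := h.nonempty
  refine ⟨⟨b, hb⟩, ?_⟩
  rintro T hT ⟨t, ht⟩ hcl x hx
  have hr := (reachable_iff_reflTransGen _ _).1 (h.preconnected ⟨t, hT ht⟩ ⟨x, hx⟩)
  have key : ∀ z : S, Relation.ReflTransGen (G.induce S).Adj ⟨t, hT ht⟩ z → z.1 ∈ T := by
    intro z hz
    induction hz with
    | refl => exact ht
    | tail _ h2 ih => exact hcl _ ih _ (Subtype.coe_prop _) h2
  exact key _ hr

theorem exists_cond {C : CGraph} (hC : C.WF) (hu : Cn C.G Set.univ)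
    (hX : ¬ EdgeSetConnected C.X) : ∃ A, Cond C A := by
  unfold EdgeSetConnected at hX
  push Not at hX
  obtain ⟨u, hus, v, hvs, huv⟩ := hX
  let V1 : Set C.V := {w | (fromEdgeSet C.X).Reachable u w}
  have hXadj : ∀ x y, s(x, y) ∈ C.X → (fromEdgeSet C.X).Adj x y := fun x y h =>
    (fromEdgeSet_adj _).2 ⟨h, (hC h : C.G.Adj x y).ne⟩
  have hV1 : ∀ x y, s(x, y) ∈ C.X → x ∈ V1 → y ∈ V1 := fun x y h hx =>
    Reachable.trans hx (hXadj x y h).reachable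
  have huV : u ∈ V1 := Reachable.refl _
  have hvV : v ∈ V1ᶜ := huv
  have cV1 : Cn C.G V1 := by
    refine ⟨⟨u, huV⟩, ?_⟩
    rintro T hT ⟨t, ht⟩ hcl x hx
    have hr := (reachable_iff_reflTransGen _ _).1 (Reachable.trans (Reachable.symm (hT ht)) hx)
    induction hr with
    | refl => exact ht
    | @tail b c h1 h2 ih =>
      have h4 := ((fromEdgeSet_adj _).1 h2).1
      exact hcl b (ih (hV1 c b (by rwa [Sym2.eq_swap]) hx)) c hx (hC h4)
  set D := cmpo C.G V1ᶜ v with hD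
  have hDs : D ⊆ V1ᶜ := cmpo_sub hvV
  have hDc : Clo C.G V1ᶜ D := cmpo_clo
  have hDx : ∀ x y, s(x, y) ∈ C.X → x ∈ D → y ∈ D := by
    intro x y hxy hx
    exact hDc x hx y (fun hy => hDs hx (hV1 y x (by rwa [Sym2.eq_swap]) hy)) (hC hxy)
  have huD : u ∉ D := fun h => hDs h huV
  refine ⟨Dᶜ, ?_, ?_, ?_, ?_, ?_⟩
  · refine cn_of_root (b := u) huD ?_
    intro T hT hne hcl
    by_contra huT
    have hTV : ∀ x ∈ T, x ∉ V1 := fun x hx hxV =>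
      huT (cV1.sub_of_clo (fun z hz h => hDs h hz) hcl hxV hx huV)
    refine huT (hu.2 T (Set.subset_univ _) hne ?_ (Set.mem_univ u))
    intro a ha b _ hab
    by_cases hb : b ∈ D
    · exact absurd (hDc b hb a (hTV a ha) hab.symm) (hT ha)
    · exact hcl a ha b hb hab
  · rw [compl_compl]
    exact cmpo_cn hvV
  · intro x y hxy
    exact not_congr ⟨hDx x y hxy, hDx y x (by rwa [Sym2.eq_swap])⟩
  · obtain ⟨w, hw⟩ := hus
    have hw' := ((fromEdgeSet_adj _).1 hw).1
    exact ⟨u, w, huD, fun h => hDs h (hV1 u w hw' huV), hw'⟩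
  · obtain ⟨w, hw⟩ := hvs
    have hw' := ((fromEdgeSet_adj _).1 hw).1
    have hvD : v ∈ D := mem_cmpo
    exact ⟨v, w, fun h => h hvD, fun h => h (hDx v w hw' hvD), hw'⟩

theorem hasObs_of_disconnected {C : CGraph} (hC : C.WF) (hk : KConnected 3 C.G)
    (hX : ¬ EdgeSetConnected C.X) : HasObs C := by
  have h3 : ∀ S : Set C.V, S.ncard < 3 → Cn C.G Sᶜ := fun S hS => cn_of_connected (hk.2 S hS)
  have h3' : ∀ x y, Cn C.G ({x, y}ᶜ : Set C.V) := by
    intro x y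
    apply h3
    have := Set.ncard_insert_le x ({y} : Set C.V)
    rw [Set.ncard_singleton] at this
    omega
  have hu : Cn C.G Set.univ := by
    have := h3 ∅ (by simp)
    rwa [Set.compl_empty] at this
  obtain ⟨A, hA⟩ := exists_cond hC hu hX
  rcases exists_twoC hC h3' hA with h | ⟨A', h1, h2, h4⟩
  · exact h
  · exact twoC_obs hC h3 h3' h1 h2 h4

end Final

/-- **Theorem 2.** A 3-connected constraint graph is constraint connected iff it has no
constraint minor isomorphic to one of the six obstructions. -/
theorem constraint_connected_iff_no_obstruction (C : CGraph) (hWF : C.WF)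
    (h3 : KConnected 3 C.G) :
    EdgeSetConnected C.X ↔ ¬ ∃ D, IsCMinor C D ∧ IsObstruction D := by
  constructor
  · rintro hX ⟨D, hD, hobs⟩
    exact obs_not_conn hobs (conn_minor hD hX)
  · intro hno
    by_contra hX
    exact hno (hasObs_of_disconnected hWF h3 hX)
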